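/- arXiv:2505.00262 — 2 statements merged into one kernel-verified Lean document; each statement's English description precedes it below -/
import Mathlib

section
/- Suppose the HNN-extension 𝔼 = ⟨B, t; t⁻¹Ht = K, φ⟩ satisfies condition (*) and 𝒞 is a root class of groups closed under taking quotient groups. If B ∈ 𝒞, then the following two statements are equivalent, and either of them implies that 𝔼 is residually a 𝒞-group: (1) there exists a homomorphism of 𝔼 onto a group from 𝒞 acting injectively on the subgroup B; (2) 𝔘 ∈ 𝒞 and 𝔙 ∈ 𝒞. -/
universe u

open Subgroup

/-- A class of groups in universe `u`: a property of groups. -/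
abbrev GroupClass : Type (u + 1) := (G : Type u) → [inst : Group G] → Prop

/-- The class is closed under isomorphism. -/
def IsoClosed (C : GroupClass.{u}) : Prop :=
  ∀ (G₁ G₂ : Type u) [Group G₁] [Group G₂], (G₁ ≃* G₂) → C G₁ → C G₂

/-- The class is closed under taking subgroups. -/
def SubgroupClosed (C : GroupClass.{u}) : Prop :=
  ∀ (G : Type u) [Group G] (H : Subgroup G), C G → C H

/-- The class is closed under taking quotient groups. -/
def QuotClosed (C : GroupClass.{u}) : Prop :=
  ∀ (G : Type u) [Group G] (N : Subgroup G) [N.Normal], C G → C (G ⧸ N)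

/-- The class is closed under direct products of a finite number of factors. -/
def FinProdClosed (C : GroupClass.{u}) : Prop :=
  ∀ (ι : Type u) [Finite ι] (G : ι → Type u) [∀ i, Group (G i)],
    (∀ i, C (G i)) → C (∀ i, G i)

/-- Gruenberg's condition. -/
def Gruenberg (C : GroupClass.{u}) : Prop :=
  ∀ (X : Type u) [Group X] (Y Z : Subgroup X) (_ : Z ≤ Y) (hY : Y.Normal)
    (hZY : (Z.subgroupOf Y).Normal), C (X ⧸ Y) → C (↥Y ⧸ Z.subgroupOf Y) →
    ∃ T : Subgroup X, ∃ _ : T.Normal, T ≤ Z ∧ C (X ⧸ T)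

/-- A root class of groups. -/
def IsRootClass (C : GroupClass.{u}) : Prop :=
  IsoClosed C ∧ (∃ (G : Type u) (_ : Group G), C G ∧ Nontrivial G) ∧
    SubgroupClosed C ∧ Gruenberg C

/-- `X` is residually a `C`-group. -/
def Residually (C : GroupClass.{u}) (X : Type u) [Group X] : Prop :=
  ∀ x : X, x ≠ 1 → ∃ (G : Type u) (_ : Group G) (f : X →* G),
    Function.Surjective f ∧ C G ∧ f x ≠ 1

/-- Every element has finite order. -/
def Periodic (G : Type u) [Group G] : Prop := ∀ g : G, IsOfFinOrder g

/-- The class consists only of periodic groups. -/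
def PeriodicClass (C : GroupClass.{u}) : Prop := ∀ (G : Type u) [Group G], C G → Periodic G

/-- `Aut_X(Y)`: the subgroup of `Aut(Y)` consisting of the restrictions to `Y`
of the inner automorphisms of `X` (that leave `Y` invariant; when `Y` is normal
in `X` these are the restrictions of all inner automorphisms of `X`). -/
def autOf (X : Type u) [Group X] (Y : Subgroup X) : Subgroup (MulAut Y) where
  carrier := { α | ∃ x : X, ∀ y : Y, ((α y : Y) : X) = x * y * x⁻¹ }
  one_mem' := ⟨1, fun y => by simp⟩
  mul_mem' := by
    rintro α β ⟨a, ha⟩ ⟨b, hb⟩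
    refine ⟨a * b, fun y => ?_⟩
    have h1 : ((α (β y) : Y) : X) = a * (β y) * a⁻¹ := ha (β y)
    have h2 : ((β y : Y) : X) = b * y * b⁻¹ := hb y
    show ((α (β y) : Y) : X) = _
    rw [h1, h2]; group
  inv_mem' := by
    rintro α ⟨a, ha⟩
    refine ⟨a⁻¹, fun y => ?_⟩
    have h : ((α (α⁻¹ y) : Y) : X) = a * (α⁻¹ y) * a⁻¹ := ha (α⁻¹ y)
    rw [MulAut.apply_inv_self] at h
    rw [h]; group

/-- Conjugation of automorphism groups along an isomorphism `φ : H ≃* K`,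
giving `φ ∘ α ∘ φ⁻¹ : Aut K →* Aut H`. -/
def autConjHom {H K : Type u} [Group H] [Group K] (φ : H ≃* K) : MulAut K →* MulAut H where
  toFun α := (φ.trans α).trans φ.symm
  map_one' := by ext x; simp
  map_mul' := fun α β => by
    ext x
    simp [MulAut.mul_apply, MulEquiv.trans_apply, MulEquiv.apply_symm_apply]

/-- `N ∈ 𝒞*(X)`: `N` is normal in `X` and `X/N ∈ 𝒞`. -/
def inCStar (C : GroupClass.{u}) (X : Type u) [Group X] (N : Subgroup X) : Prop :=
  ∃ _ : N.Normal, C (X ⧸ N)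

/-- `X` is `𝒞`-quasi-regular with respect to its subgroup `Y`. -/
def QuasiRegular (C : GroupClass.{u}) (X : Type u) [Group X] (Y : Subgroup X) : Prop :=
  ∀ M : Subgroup Y, inCStar C Y M → ∃ N : Subgroup X, inCStar C X N ∧ N.subgroupOf Y ≤ M

/-- `𝔓(𝒞)`: the set of primes dividing the order of some element of some `𝒞`-group. -/
def primesOf (C : GroupClass.{u}) : Set ℕ :=
  { p | p.Prime ∧ ∃ (Z : Type u) (_ : Group Z), C Z ∧ ∃ z : Z, p ∣ orderOf z }

/-- `Y` is `𝔓(𝒞)′`-isolated in `X`. -/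
def PIsolated (C : GroupClass.{u}) {X : Type u} [Group X] (Y : Subgroup X) : Prop :=
  ∀ (x : X) (q : ℕ), q.Prime → q ∉ primesOf C → x ^ q ∈ Y → x ∈ Y

/-- Every finitely generated subgroup is cyclic. -/
def LocallyCyclic (G : Type u) [Group G] : Prop :=
  ∀ S : Subgroup G, S.FG → IsCyclic S

/-- `A` is a `𝒞`-bounded abelian group. -/
def CBoundedAbelian (C : GroupClass.{u}) (A : Type u) [Group A] : Prop :=
  (∀ a b : A, a * b = b * a) ∧
  ∀ (N : Subgroup A), ∀ _ : N.Normal, ∀ p ∈ primesOf C,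
    (∃ m : ℕ, 0 < m ∧ ∀ x : A ⧸ N, (∃ n : ℕ, x ^ p ^ n = 1) → x ^ m = 1) ∧
    (∃ (Z : Type u) (_ : Group Z), C Z ∧
      Cardinal.mk {x : A ⧸ N // ∃ n : ℕ, x ^ p ^ n = 1} ≤ Cardinal.mk Z)

/-- `X` is a `𝒞`-bounded nilpotent group: it has a finite central series with
`𝒞`-bounded abelian factors. -/
def CBoundedNilpotent (C : GroupClass.{u}) (X : Type u) [Group X] : Prop :=
  ∃ (n : ℕ) (S : ℕ → Subgroup X), S 0 = ⊥ ∧ S n = ⊤ ∧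
    (∀ i < n, S i ≤ S (i + 1)) ∧ (∀ i < n, (S i).Normal) ∧
    (∀ i < n, ∀ x ∈ S (i + 1), ∀ g : X, g⁻¹ * x⁻¹ * g * x ∈ S i) ∧
    (∀ i < n, ∀ _ : ((S i).subgroupOf (S (i + 1))).Normal,
      CBoundedAbelian C (↥(S (i + 1)) ⧸ (S i).subgroupOf (S (i + 1))))

/-- `A` is a normal subgroup of `U` (as subgroups of a common group). -/
def NormalIn {G : Type u} [Group G] (A U : Subgroup G) : Prop := (A.subgroupOf U).Normal

/-- `G` satisfies a non-trivial identity. -/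
def SatisfiesNontrivialIdentity (G : Type u) [Group G] : Prop :=
  ∃ w : FreeGroup ℕ, w ≠ 1 ∧ ∀ f : FreeGroup ℕ →* G, f w = 1

section HNN

variable {B : Type u} [Group B] (H K : Subgroup B) (φ : H ≃* K)

/-- `𝔎 = φ ∘ Aut_B(K) ∘ φ⁻¹`, as a subgroup of `Aut(H)`. -/
def frakK : Subgroup (MulAut H) := (autOf B K).map (autConjHom φ)

/-- `𝔘 = ⟨𝔥, 𝔎⟩ ≤ Aut(H)`. -/
def frakU : Subgroup (MulAut H) := autOf B H ⊔ frakK H K φ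

/-- `𝔙 = ⟨𝔏, 𝔉⟩ ≤ Aut(L)`, where `ψ = φ|_L`. -/
def frakV (ψ : MulAut ↥(H ⊓ K)) : Subgroup (MulAut ↥(H ⊓ K)) :=
  autOf B (H ⊓ K) ⊔ Subgroup.zpowers ψ

/-- `ψ` is the restriction of `φ` to `L = H ⊓ K` (this encodes the
`φ`-invariance of `L` from condition (*)). -/
def IsRestrictionToL (ψ : MulAut ↥(H ⊓ K)) : Prop :=
  ∀ x : ↥(H ⊓ K), ((ψ x : ↥(H ⊓ K)) : B) = ((φ ⟨(x : B), x.2.1⟩ : K) : B)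

/-- `(H ⊓ K)φ = H ⊓ K` : the `φ`-invariance of `L` from condition (*). -/
def PhiInvL : Prop :=
  ((H ⊓ K).subgroupOf H).map φ.toMonoidHom = (H ⊓ K).subgroupOf K

end HNN

section HNNExtra

variable (C : GroupClass.{u}) {B : Type u} [Group B] (H K : Subgroup B) (φ : H ≃* K)

/-- Condition (†): at least one of `𝔥` and `𝔎` is normal in `𝔘`, or `𝔘 ∈ 𝒞`. -/
def CondDag : Prop :=
  NormalIn (autOf B H) (frakU H K φ) ∨ NormalIn (frakK H K φ) (frakU H K φ) ∨
    C ↥(frakU H K φ)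

/-- Condition (‡): at least one of `𝔏` and `𝔉` is normal in `𝔙`, or `𝔙 ∈ 𝒞`. -/
def CondDDag (ψ : MulAut ↥(H ⊓ K)) : Prop :=
  NormalIn (autOf B (H ⊓ K)) (frakV H K ψ) ∨
    NormalIn (Subgroup.zpowers ψ) (frakV H K ψ) ∨ C ↥(frakV H K ψ)

/-- `Q` is a pre-`𝒞`-admissible subgroup of `B`: it is normal, `(H,K,φ)`-compatible,
`B/Q ∈ 𝒞`, and `HQ/Q ∩ KQ/Q = LQ/Q`. -/
def PreAdmissible (Q : Subgroup B) : Prop :=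
  ∃ _ : Q.Normal, ((Q ⊓ H).subgroupOf H).map φ.toMonoidHom = (Q ⊓ K).subgroupOf K ∧
    C (B ⧸ Q) ∧
    (H.map (QuotientGroup.mk' Q)) ⊓ (K.map (QuotientGroup.mk' Q)) =
      (H ⊓ K).map (QuotientGroup.mk' Q)

end HNNExtra

namespace IsRootClass

variable {C : GroupClass.{u}} (hC : IsRootClass C)
include hC

theorem of_injective {X Y : Type u} [Group X] [Group Y] (f : X →* Y)
    (hf : Function.Injective f) (hY : C Y) : C X :=
  hC.1 f.range X (MonoidHom.ofInjective hf).symm (hC.2.2.1 Y f.range hY)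

theorem of_surjective (hquot : QuotClosed C) {X Y : Type u} [Group X] [Group Y] (f : X →* Y)
    (hf : Function.Surjective f) (hX : C X) : C Y :=
  hC.1 _ _ (QuotientGroup.quotientKerEquivOfSurjective f hf) (hquot X f.ker hX)

theorem of_le_range (hquot : QuotClosed C) {X Y : Type u} [Group X] [Group Y] (f : X →* Y)
    {U : Subgroup Y} (hU : U ≤ f.range) (hX : C X) : C U := by
  refine hC.of_surjective hquot (f.subgroupComap U) ?_ (hC.2.2.1 X (U.comap f) hX)
  rintro ⟨y, hy⟩
  obtain ⟨x, rfl⟩ := hU hy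
  exact ⟨⟨x, hy⟩, rfl⟩

theorem of_subsingleton (X : Type u) [Group X] [Subsingleton X] : C X := by
  obtain ⟨G, _, hG, -⟩ := hC.2.1
  exact hC.of_injective (1 : X →* G) (Function.injective_of_subsingleton _) hG

/-- Gruenberg's condition for the kernels of homomorphisms into groups of the class. -/
theorem exists_normal_le_ker {X Q D : Type u} [Group X] [Group Q] [Group D] (q : X →* Q)
    (π : q.ker →* D) (hQ : C Q) (hD : C D) :
    ∃ T : Subgroup X, ∃ _ : T.Normal, T ≤ π.ker.map q.ker.subtype ∧ C (X ⧸ T) := by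
  have hsub : (π.ker.map q.ker.subtype).subgroupOf q.ker = π.ker :=
    Subgroup.comap_map_eq_self_of_injective q.ker.subtype_injective _
  have hn : ((π.ker.map q.ker.subtype).subgroupOf q.ker).Normal := by
    rw [hsub]; infer_instance
  refine hC.2.2.2 X q.ker (π.ker.map q.ker.subtype) (Subgroup.map_subtype_le _) inferInstance hn
    (hC.of_injective (QuotientGroup.kerLift q) (QuotientGroup.kerLift_injective q) hQ) ?_
  refine hC.of_injective ((QuotientGroup.kerLift π).comp
    (QuotientGroup.quotientMulEquivOfEq hsub).toMonoidHom) ?_ hD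
  exact (QuotientGroup.kerLift_injective π).comp
    (QuotientGroup.quotientMulEquivOfEq hsub).injective

/-- If no nontrivial element of the kernel of `q` has all its conjugates in the kernel of `π`,
then the group belongs to the class. -/
theorem of_core_trivial {X Q D : Type u} [Group X] [Group Q] [Group D] (q : X →* Q)
    (π : q.ker →* D) (hQ : C Q) (hD : C D)
    (h : ∀ y : X, ∀ hy : y ∈ q.ker,
      (∀ x : X, π ⟨x * y * x⁻¹, Subgroup.Normal.conj_mem inferInstance y hy x⟩ = 1) → y = 1) :
    C X := by
  obtain ⟨T, hT, hle, hCT⟩ := hC.exists_normal_le_ker q π hQ hD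
  have hbot : T = ⊥ := by
    rw [Subgroup.eq_bot_iff_forall]
    intro y hy
    obtain ⟨⟨y', hy'⟩, -, rfl⟩ := hle hy
    refine h _ hy' fun x => ?_
    obtain ⟨⟨z, hz⟩, hz1, hzy⟩ := hle (hT.conj_mem _ hy x)
    simp only [Subgroup.subtype_apply] at hzy
    subst hzy
    exact hz1
  subst hbot
  exact hC.1 _ _ QuotientGroup.quotientBot hCT

theorem wreath {D Q : Type u} [Group D] [Group Q] (hD : C D) (hQ : C Q) : C (D ≀ᵣ Q) := by
  let π : (RegularWreathProduct.rightHom : D ≀ᵣ Q →* Q).ker →* D :=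
    { toFun := fun x => x.1.left 1
      map_one' := rfl
      map_mul' := by
        rintro ⟨x, hx⟩ ⟨y, hy⟩
        have hx' : x.right = 1 := hx
        simp [hx'] }
  refine hC.of_core_trivial RegularWreathProduct.rightHom π hQ hD fun y hy h => ?_
  have hy' : y.right = 1 := hy
  ext q
  · have := h (RegularWreathProduct.inl q⁻¹)
    simpa [π, hy'] using this
  · simpa using hy'

theorem semidirect {A U : Type u} [Group A] [Group U] (θ : U →* MulAut A)
    (hA : C A) (hU : C U) : C (A ⋊[θ] U) := by
  let π : (SemidirectProduct.rightHom : A ⋊[θ] U →* U).ker →* A :=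
    { toFun := fun x => x.1.left
      map_one' := rfl
      map_mul' := by
        rintro ⟨x, hx⟩ ⟨y, hy⟩
        have hx' : x.right = 1 := hx
        simp [hx'] }
  refine hC.of_core_trivial SemidirectProduct.rightHom π hU hA fun y hy h => ?_
  have h1 := h 1
  ext
  · simpa [π] using h1
  · exact hy

theorem prod {A U : Type u} [Group A] [Group U] (hA : C A) (hU : C U) : C (A × U) :=
  hC.of_injective (SemidirectProduct.mulEquivProd (N := A) (G := U)).symm.toMonoidHom
    (MulEquiv.injective _) (hC.semidirect 1 hA hU)

/-- Finitely many elements that can be separated from `1` one at a time by homomorphisms into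
groups of the class can be separated simultaneously. -/
theorem exists_hom_forall_ne_one {F : Type u} [Group F] (S : List F)
    (hS : ∀ s ∈ S, ∃ (G : Type u) (_ : Group G) (f : F →* G), C G ∧ f s ≠ 1) :
    ∃ (G : Type u) (_ : Group G) (f : F →* G), C G ∧ ∀ s ∈ S, f s ≠ 1 := by
  induction S with
  | nil => exact ⟨PUnit, inferInstance, 1, hC.of_subsingleton _, by simp⟩
  | cons a S ih =>
    obtain ⟨G₁, _, f₁, h₁, h₁'⟩ := hS a List.mem_cons_self
    obtain ⟨G₂, _, f₂, h₂, h₂'⟩ := ih fun s hs => hS s (List.mem_cons_of_mem _ hs)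
    refine ⟨G₁ × G₂, inferInstance, f₁.prod f₂, hC.prod h₁ h₂, ?_⟩
    intro s hs h
    rw [MonoidHom.prod_apply, Prod.mk_eq_one] at h
    rcases List.mem_cons.1 hs with rfl | hs
    · exact h₁' h.1
    · exact h₂' s hs h.2

end IsRootClass

section FreeGroup

variable {Ω G A : Type u} [Group G] [Group A]

open Classical in
/-- The homomorphism from a free group to a wreath product that lifts `f` and whose first component
records the passages of a path through the edge at `1` with label `i₀`, oriented oppositely to
the letter `(i₀, b₀)`. -/
noncomputable def edgeHom (f : FreeGroup Ω →* G) (a : A) (i₀ : Ω) (b₀ : Bool) :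
    FreeGroup Ω →* A ≀ᵣ G :=
  FreeGroup.lift fun i =>
    if b₀ then
      (⟨fun g => if g = 1 ∧ i = i₀ then a else 1, f (FreeGroup.mk [(i, !b₀)])⟩ : A ≀ᵣ G)⁻¹
    else ⟨fun g => if g = 1 ∧ i = i₀ then a else 1, f (FreeGroup.mk [(i, !b₀)])⟩

theorem freeGroup_mk_cons (l : Ω × Bool) (T : List (Ω × Bool)) :
    FreeGroup.mk (l :: T) = FreeGroup.mk [l] * FreeGroup.mk T := by
  rw [FreeGroup.mul_mk, List.singleton_append]

theorem freeGroup_mk_not (i : Ω) (b : Bool) :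
    FreeGroup.mk [(i, !b)] = (FreeGroup.mk [(i, b)])⁻¹ := by
  simp [FreeGroup.inv_mk, FreeGroup.invRev]

variable (f : FreeGroup Ω →* G) (a : A) (i₀ : Ω) (b₀ : Bool)

open Classical in
theorem edgeHom_mk_not (i : Ω) :
    edgeHom f a i₀ b₀ (FreeGroup.mk [(i, !b₀)]) =
      ⟨fun g => if g = 1 ∧ i = i₀ then a else 1, f (FreeGroup.mk [(i, !b₀)])⟩ := by
  cases b₀ <;> simp [edgeHom, FreeGroup.lift_mk]

open Classical in
theorem edgeHom_mk_self (i : Ω) :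
    edgeHom f a i₀ b₀ (FreeGroup.mk [(i, b₀)]) =
      ⟨fun g => if g = f (FreeGroup.mk [(i, b₀)]) ∧ i = i₀ then a⁻¹ else 1,
        f (FreeGroup.mk [(i, b₀)])⟩ := by
  have h := freeGroup_mk_not i (!b₀)
  rw [Bool.not_not] at h
  simp only [h, map_inv, edgeHom_mk_not]
  ext g
  · simp only [RegularWreathProduct.inv_left, Pi.inv_apply, mul_eq_one_iff_eq_inv']
    split_ifs <;> simp
  · rfl

theorem edgeHom_right (w : FreeGroup Ω) : (edgeHom f a i₀ b₀ w).right = f w := by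
  have : RegularWreathProduct.rightHom.comp (edgeHom f a i₀ b₀) = f := by
    ext i
    rcases eq_or_ne b₀ true with rfl | hb
    · exact congrArg RegularWreathProduct.right (edgeHom_mk_self f a i₀ true i)
    · obtain rfl : b₀ = false := by simpa using hb
      exact congrArg RegularWreathProduct.right (edgeHom_mk_not f a i₀ false i)
  exact DFunLike.congr_fun this w

theorem edgeHom_left_eq_one (T : List (Ω × Bool)) (x : G)
    (hx : ∀ l ∈ T.head?, l = (i₀, !b₀) → x ≠ 1)
    (hT : ∀ T', T' ≠ [] → T' <+: T → f (FreeGroup.mk T') ≠ x) :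
    (edgeHom f a i₀ b₀ (FreeGroup.mk T)).left x = 1 := by
  induction T generalizing x with
  | nil => rw [← FreeGroup.one_eq_mk, map_one]; rfl
  | cons l T ih =>
    have h1 : f (FreeGroup.mk [l]) ≠ x := hT [l] (by simp) (by simp)
    rw [freeGroup_mk_cons, map_mul, RegularWreathProduct.mul_left, Pi.mul_apply, edgeHom_right,
      ih, mul_one]
    · obtain ⟨i, b⟩ := l
      by_cases hb : b = b₀
      · subst hb
        rw [edgeHom_mk_self]
        exact if_neg fun h => h1 h.1.symm
      · obtain rfl : b = !b₀ := by cases b <;> cases b₀ <;> simp_all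
        rw [edgeHom_mk_not]
        refine if_neg fun h => hx (i, !b₀) (by simp) (by rw [h.2]) h.1
    · rintro - - - h
      exact h1 (inv_mul_eq_one.1 h)
    · intro T' hne hT' h
      refine hT (l :: T') (by simp) (List.cons_prefix_cons.2 ⟨rfl, hT'⟩) ?_
      rw [freeGroup_mk_cons, map_mul, h, mul_inv_cancel_left]

theorem freeGroup_mk_ne_one {L : List (Ω × Bool)} (hL : FreeGroup.IsReduced L) (hne : L ≠ []) :
    FreeGroup.mk L ≠ 1 := by
  classical
  rw [Ne, ← FreeGroup.toWord_eq_nil_iff, FreeGroup.toWord_mk, hL.reduce_eq]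
  exact hne

/-- Free groups are residually in every root class. -/
theorem IsRootClass.exists_hom_freeGroup_ne_one {C : GroupClass.{u}} (hC : IsRootClass C)
    {w : FreeGroup Ω} (hw : w ≠ 1) :
    ∃ (G : Type u) (_ : Group G) (f : FreeGroup Ω →* G), C G ∧ f w ≠ 1 := by
  classical
  obtain ⟨A, _, hA, _⟩ := hC.2.1
  obtain ⟨a, ha⟩ := exists_ne (1 : A)
  suffices key : ∀ (n : ℕ) (L : List (Ω × Bool)), L.length ≤ n → FreeGroup.IsReduced L → L ≠ [] →
      ∃ (G : Type u) (_ : Group G) (f : FreeGroup Ω →* G), C G ∧ f (FreeGroup.mk L) ≠ 1 by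
    have := key _ w.toWord le_rfl FreeGroup.isReduced_toWord
      (by rwa [Ne, FreeGroup.toWord_eq_nil_iff])
    rwa [FreeGroup.mk_toWord] at this
  intro n
  induction n with
  | zero =>
    intro L hlen _ hne
    exact absurd (List.length_eq_zero_iff.1 (Nat.le_zero.1 hlen)) hne
  | succ n ih =>
    intro L hlen hred hne
    obtain ⟨⟨i₀, b₀⟩, T, rfl⟩ := List.exists_cons_of_ne_nil hne
    have hTred : FreeGroup.IsReduced T := hred.infix (List.suffix_cons _ _).isInfix
    obtain ⟨G, _, f, hG, hf⟩ := hC.exists_hom_forall_ne_one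
      ((T.inits.filter (· ≠ [])).map FreeGroup.mk) (by
        intro s hs
        obtain ⟨T', hT', rfl⟩ := List.mem_map.1 hs
        rw [List.mem_filter, List.mem_inits] at hT'
        refine ih T' ?_ (hTred.infix hT'.1.isInfix) (by simpa using hT'.2)
        have := hT'.1.length_le
        simp only [List.length_cons] at hlen
        omega)
    refine ⟨A ≀ᵣ G, inferInstance, edgeHom f a i₀ b₀, hC.wreath hA hG, fun h => ?_⟩
    have h0 := congrFun (congrArg RegularWreathProduct.left h) (f (FreeGroup.mk [(i₀, b₀)]))
    rw [freeGroup_mk_cons, map_mul, RegularWreathProduct.mul_left, Pi.mul_apply, edgeHom_right,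
      edgeHom_left_eq_one (T := T), mul_one, edgeHom_mk_self] at h0
    · simp [ha] at h0
    · rintro l hl rfl
      cases T with
      | nil => simp at hl
      | cons l' T =>
        obtain rfl : l' = (i₀, !b₀) := by simpa using hl
        have := (FreeGroup.isReduced_cons_cons.1 hred).1 rfl
        simp at this
    · intro T' hne' hT' h1
      rw [inv_mul_cancel] at h1
      refine hf _ (List.mem_map.2 ⟨T', ?_, rfl⟩) h1
      rw [List.mem_filter, List.mem_inits]
      exact ⟨hT', by simpa using hne'⟩

end FreeGroup

section Kernel

/-- The automorphisms of a free group induced by an action on its basis. -/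
def freeGroupAction (G Ω : Type u) [Group G] [MulAction G Ω] : G →* MulAut (FreeGroup Ω) where
  toFun g := FreeGroup.freeGroupCongr (MulAction.toPerm g)
  map_one' := by
    apply MulEquiv.toMonoidHom_injective
    ext x
    simp [one_smul]
  map_mul' g h := by
    apply MulEquiv.toMonoidHom_injective
    ext x
    simp [mul_smul]

@[simp]
theorem freeGroupAction_of {G Ω : Type u} [Group G] [MulAction G Ω] (g : G) (x : Ω) :
    freeGroupAction G Ω g (FreeGroup.of x) = FreeGroup.of (g • x) := by
  simp [freeGroupAction]

variable {B G : Type u} [Group B] [Group G] {H K : Subgroup B} {φ : H ≃* K}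
  (f : HNNExtension B H K φ →* G)

/-- The image in `G` of the subgroup `K`, whose cosets label the conjugates of the letter. -/
abbrev imageK : Subgroup G := K.map (f.comp HNNExtension.of)

/-- The homomorphism from the HNN-extension to the semidirect product of a free group on the cosets
of the image of `K` and the group `G` that extends `f`. -/
def treeHom : HNNExtension B H K φ →*
    FreeGroup (G ⧸ imageK f) ⋊[freeGroupAction G (G ⧸ imageK f)] G :=
  HNNExtension.lift (SemidirectProduct.inr.comp (f.comp HNNExtension.of))
    ⟨FreeGroup.of ((1 : G) : G ⧸ imageK f), f HNNExtension.t⟩ (by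
      intro a
      have hfix : f (HNNExtension.of (φ a : B)) • ((1 : G) : G ⧸ imageK f) =
          ((1 : G) : G ⧸ imageK f) := by
        rw [MulAction.Quotient.smul_coe, QuotientGroup.eq]
        simpa using ⟨(φ a : B), (φ a).2, rfl⟩
      ext
      · simp [hfix]
      · simp [← map_mul, HNNExtension.t_mul_of])

@[simp]
theorem treeHom_of (b : B) :
    treeHom f (HNNExtension.of b) = SemidirectProduct.inr (f (HNNExtension.of b)) := by
  simp [treeHom]

@[simp]
theorem treeHom_t :
    treeHom f HNNExtension.t = ⟨FreeGroup.of ((1 : G) : G ⧸ imageK f), f HNNExtension.t⟩ := by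
  simp [treeHom]

@[simp]
theorem treeHom_right (x : HNNExtension B H K φ) : (treeHom f x).right = f x := by
  have : SemidirectProduct.rightHom.comp (treeHom f) = f := by
    ext <;> simp
  exact DFunLike.congr_fun this x

/-- The word in the free group that corresponds to a word of the HNN-extension. -/
def treeWord (p : G) : List (ℤˣ × B) → List ((G ⧸ imageK f) × Bool)
  | [] => []
  | x :: l =>
    (if x.1 = 1 then ((p : G ⧸ imageK f), true)
      else (((p * (f HNNExtension.t)⁻¹ : G) : G ⧸ imageK f), false)) ::
    treeWord (p * f (HNNExtension.t ^ (x.1 : ℤ) * HNNExtension.of x.2)) l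

theorem mk_treeWord (p : G) (l : List (ℤˣ × B)) :
    FreeGroup.mk (treeWord f p l) = freeGroupAction G (G ⧸ imageK f) p
      (treeHom f (l.map fun x => HNNExtension.t ^ (x.1 : ℤ) * HNNExtension.of x.2).prod).left := by
  induction l generalizing p with
  | nil => simp [treeWord, ← FreeGroup.one_eq_mk]
  | cons x l ih =>
    rw [treeWord, freeGroup_mk_cons, ih, List.map_cons, List.prod_cons, map_mul (treeHom f),
      SemidirectProduct.mul_left, map_mul, treeHom_right, map_mul, MulAut.mul_apply]
    obtain ⟨u, g⟩ := x
    rcases Int.units_eq_one_or u with rfl | rfl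
    · simp [← FreeGroup.of.eq_1]
    · have hne : ((-1 : ℤˣ) = 1) = False := by decide
      have hs : (freeGroupAction G (G ⧸ imageK f) (f HNNExtension.t)).symm
          (FreeGroup.of ((1 : G) : G ⧸ imageK f)) =
          FreeGroup.of ((f HNNExtension.t)⁻¹ • ((1 : G) : G ⧸ imageK f)) := by
        rw [MulEquiv.symm_apply_eq]
        simp
      simp only [hne, if_false]
      simp [hs]
      rfl

theorem isReduced_treeWord
    (hH : ∀ b, f (HNNExtension.of b) ∈ H.map (f.comp HNNExtension.of) → b ∈ H)
    (hK : ∀ b, f (HNNExtension.of b) ∈ imageK f → b ∈ K) (p : G) (l : List (ℤˣ × B))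
    (hl : l.IsChain fun a b => a.2 ∈ HNNExtension.toSubgroup H K a.1 → a.1 = b.1) :
    FreeGroup.IsReduced (treeWord f p l) := by
  induction l generalizing p with
  | nil => exact .nil
  | cons x l ih =>
    cases l with
    | nil => exact .singleton
    | cons y l =>
      rw [List.isChain_cons_cons] at hl
      rw [treeWord, treeWord, FreeGroup.isReduced_cons_cons, ← treeWord]
      refine ⟨?_, ih _ hl.2⟩
      obtain ⟨u, g⟩ := x
      obtain ⟨v, g'⟩ := y
      have hne : ((-1 : ℤˣ) = 1) = False := by decide
      rcases Int.units_eq_one_or u with rfl | rfl <;> rcases Int.units_eq_one_or v with rfl | rfl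
      · simp
      · have hg : g ∉ H := fun hg => by simpa using hl.1 hg
        simp only [hne, if_true, if_false, reduceCtorEq, imp_false]
        intro h
        obtain ⟨k, hk, hk'⟩ := QuotientGroup.eq.1 h
        refine hg (hH g ⟨φ.symm ⟨k, hk⟩, (φ.symm ⟨k, hk⟩).2, ?_⟩)
        have hc := HNNExtension.equiv_symm_eq_conj (φ := φ) ⟨k, hk⟩
        simp only [MonoidHom.comp_apply] at hk' ⊢
        rw [hc, map_mul, map_mul, hk']
        simp [mul_assoc]
      · have hg : g ∉ K := fun hg => by simpa using hl.1 hg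
        simp only [hne, if_true, if_false, reduceCtorEq, imp_false]
        intro h
        have h' := QuotientGroup.eq.1 h
        simp [mul_assoc] at h'
        exact hg (hK g (by simpa using h'))
      · simp [hne]

/-- The restriction of a homomorphism of an HNN-extension to its kernel is, modulo the base group,
an embedding into a free group, provided that the kernel meets the base group in a subgroup of both
associated subgroups. -/
theorem exists_hom_ker_freeGroup (hH : ∀ b, f (HNNExtension.of b) = 1 → b ∈ H ⊓ K) :
    ∃ (Ω : Type u) (θ : f.ker →* FreeGroup Ω),
      ∀ x, θ x = 1 ↔ (x : HNNExtension B H K φ) ∈ (HNNExtension.of : B →* _).range := by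
  have hmem : ∀ N : Subgroup B, H ⊓ K ≤ N → ∀ b,
      f (HNNExtension.of b) ∈ N.map (f.comp HNNExtension.of) → b ∈ N := by
    rintro N hN b ⟨n, hn, hnb⟩
    have := hN (hH (n⁻¹ * b) (by rw [map_mul, map_inv, map_mul, map_inv, ← hnb]; simp))
    simpa using N.mul_mem hn this
  let θ : f.ker →* FreeGroup (G ⧸ imageK f) :=
    { toFun := fun x => (treeHom f x).left
      map_one' := by simp
      map_mul' := by
        rintro ⟨x, hx⟩ ⟨y, hy⟩
        rw [MonoidHom.mem_ker] at hx
        simp [hx] }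
  refine ⟨G ⧸ imageK f, θ, ?_⟩
  rintro ⟨x, hx⟩
  change (treeHom f x).left = 1 ↔ x ∈ _
  constructor
  · intro h
    obtain ⟨d⟩ := HNNExtension.NormalWord.TransversalPair.nonempty B H K
    obtain ⟨w, rfl⟩ := (HNNExtension.NormalWord.equiv φ d).symm.surjective x
    change (treeHom f (w.toReducedWord.prod φ)).left = 1 at h
    change w.toReducedWord.prod φ ∈ _
    rw [HNNExtension.NormalWord.ReducedWord.prod] at h ⊢
    rw [map_mul, treeHom_of, SemidirectProduct.mul_left, SemidirectProduct.left_inr,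
      SemidirectProduct.right_inr, one_mul, ← mk_treeWord] at h
    have hnil : treeWord f (f (HNNExtension.of w.head)) w.toList = [] := by
      by_contra hne
      exact freeGroup_mk_ne_one (isReduced_treeWord f (hmem H inf_le_left) (hmem K inf_le_right)
        _ _ w.chain) hne h
    cases hw : w.toList with
    | nil => simp
    | cons y l => simp [hw, treeWord] at hnil
  · rintro ⟨b, rfl⟩
    simp

/-- An HNN-extension with a homomorphism into a group of a root class that is injective on the base
group is residually in the class. -/
theorem IsRootClass.residually_of_injective {C : GroupClass.{u}} (hC : IsRootClass C) (hG : C G)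
    (hf : Function.Injective (f.comp HNNExtension.of)) : Residually C (HNNExtension B H K φ) := by
  have hb : ∀ b, f (HNNExtension.of b) = 1 → b = 1 := fun b hb => hf (by simpa using hb)
  intro x hx
  suffices ∃ (G' : Type u) (_ : Group G') (f' : HNNExtension B H K φ →* G'), C G' ∧ f' x ≠ 1 by
    obtain ⟨G', _, f', hG', hx'⟩ := this
    exact ⟨f'.range, inferInstance, f'.rangeRestrict, f'.rangeRestrict_surjective,
      hC.2.2.1 G' _ hG', fun h => hx' (congrArg Subtype.val h)⟩
  by_cases hfx : f x = 1
  · obtain ⟨Ω, θ, hθ⟩ := exists_hom_ker_freeGroup f fun b h => hb b h ▸ one_mem _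
    have hθx : θ ⟨x, hfx⟩ ≠ 1 := by
      rw [Ne, hθ]
      rintro ⟨b, rfl⟩
      exact hx (by rw [hb b hfx, map_one])
    obtain ⟨P, _, g, hP, hg⟩ := hC.exists_hom_freeGroup_ne_one hθx
    obtain ⟨T, hT, hle, hCT⟩ := hC.exists_normal_le_ker f (g.comp θ) hG hP
    refine ⟨_, _, QuotientGroup.mk' T, hCT, fun h => ?_⟩
    obtain ⟨⟨y, hy⟩, hy1, rfl⟩ := hle ((QuotientGroup.eq_one_iff x).1 h)
    exact hg hy1
  · exact ⟨G, inferInstance, f, hG, hfx⟩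

end Kernel

section Necessity

variable {B G : Type u} [Group B] [Group G]

/-- The automorphisms of a subgroup `N` induced by conjugations in an overgroup all come from one
action, that of the normalizer of `N`. -/
theorem exists_hom_mulAut_of_conj (i : B →* G) (hi : Function.Injective i) (N : Subgroup B) :
    ∃ (M : Subgroup G) (ν : M →* MulAut N), ∀ (α : MulAut N) (g : G),
      (∀ y : N, i (α y) = g * i y * g⁻¹) → α ∈ ν.range := by
  let e := N.equivMapOfInjective i hi
  refine ⟨_, (MulAut.congr e.symm).toMonoidHom.comp (N.map i).normalizerMonoidHom, ?_⟩
  intro α g h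
  have hg : g ∈ normalizer (N.map i : Set G) := by
    rw [Subgroup.mem_normalizer_iff]
    intro x
    constructor
    · rintro ⟨y, hy, rfl⟩
      exact ⟨α ⟨y, hy⟩, (α ⟨y, hy⟩).2, h ⟨y, hy⟩⟩
    · rintro ⟨y, hy, hyx⟩
      refine ⟨α.symm ⟨y, hy⟩, (α.symm ⟨y, hy⟩).2, ?_⟩
      have := h (α.symm ⟨y, hy⟩)
      rw [MulEquiv.apply_symm_apply, hyx] at this
      simpa using this.symm
  refine ⟨⟨g, hg⟩, ?_⟩
  ext y
  apply hi
  rw [h]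
  have : ∀ z, i (e.symm z : N) = z := fun z => by
    obtain ⟨z, rfl⟩ := e.surjective z
    simp [e]
  exact this _

variable {C : GroupClass.{u}} {H K : Subgroup B} {φ : H ≃* K} (hC : IsRootClass C)
  (hquot : QuotClosed C) (f : HNNExtension B H K φ →* G) (hG : C G)
  (hf : Function.Injective (f.comp HNNExtension.of))

include hC hquot hG hf

theorem frakU_of_injective : C (frakU H K φ) := by
  obtain ⟨M, ν, hν⟩ := exists_hom_mulAut_of_conj _ hf H
  refine hC.of_le_range hquot ν (sup_le ?_ ?_) (hC.2.2.1 G M hG)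
  · rintro α ⟨b, hb⟩
    refine hν α (f (HNNExtension.of b)) fun y => ?_
    simp [hb]
  · rintro _ ⟨α, ⟨b, hb⟩, rfl⟩
    refine hν _ (f (HNNExtension.t⁻¹ * HNNExtension.of b * HNNExtension.t)) fun y => ?_
    have h1 := HNNExtension.equiv_symm_eq_conj (φ := φ) (α (φ y))
    have h2 := HNNExtension.equiv_eq_conj (φ := φ) y
    change f (HNNExtension.of ((φ.symm (α (φ y)) : H) : B)) = _
    rw [h1, hb]
    simp only [map_mul, h2, map_inv]
    simp [mul_assoc]

theorem frakV_of_injective {ψ : MulAut ↥(H ⊓ K)} (hψ : IsRestrictionToL H K φ ψ) :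
    C (frakV H K ψ) := by
  obtain ⟨M, ν, hν⟩ := exists_hom_mulAut_of_conj _ hf (H ⊓ K)
  refine hC.of_le_range hquot ν (sup_le ?_ ?_) (hC.2.2.1 G M hG)
  · rintro α ⟨b, hb⟩
    refine hν α (f (HNNExtension.of b)) fun y => ?_
    simp [hb]
  · rw [Subgroup.zpowers_le]
    refine hν _ (f HNNExtension.t) fun y => ?_
    rw [hψ, MonoidHom.comp_apply, HNNExtension.equiv_eq_conj]
    simp

end Necessity

section Sufficiency

section Cocycle

variable {B D : Type u} [Group B] [Group D]

/-- An equivariant homomorphism of a normal subgroup `H` that is trivial on the intersection with a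
normal subgroup `K` gives a cocycle of the group over its quotient by `H ⊔ K`. -/
theorem exists_cocycle (H K R : Subgroup B) [hH : H.Normal] [hK : K.Normal] [R.Normal]
    (hR : R = H ⊔ K) (η : H →* D) (hη : ∀ h : H, (h : B) ∈ K → η h = 1) (α : B →* D)
    (hα : ∀ b h, α b * η h * (α b)⁻¹ = η (MulAut.conjNormal b h)) :
    ∃ c : B → B ⧸ R → D, (∀ b b' q, c (b * b') q = c b q * c b' ((b : B ⧸ R)⁻¹ * q)) ∧
      ∀ (h : H) (k : K) q, c (h * k) q = η h := by
  classical
  have hmem : ∀ r ∈ R, ∃ p : H × K, r = p.1 * p.2 := by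
    intro r hr
    rw [hR, Subgroup.mem_sup_of_normal_right] at hr
    obtain ⟨h, hh, k, hk, rfl⟩ := hr
    exact ⟨(⟨h, hh⟩, ⟨k, hk⟩), rfl⟩
  let ρ : B → D := fun b => if hb : ∃ p : H × K, b = p.1 * p.2 then η hb.choose.1 else 1
  have hρ : ∀ (h : H) (k : K), ρ (h * k) = η h := by
    intro h k
    have hb : ∃ p : H × K, (h * k : B) = p.1 * p.2 := ⟨(h, k), rfl⟩
    simp only [ρ, dif_pos hb]
    have hs := hb.choose_spec
    set p := hb.choose
    rw [← inv_mul_eq_one, ← map_inv, ← map_mul]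
    apply hη
    have : ((p.1⁻¹ * h : H) : B) = p.2 * (k : B)⁻¹ := by
      rw [eq_mul_inv_iff_mul_eq]
      push_cast
      rw [mul_assoc, hs]
      group
    rw [this]
    exact K.mul_mem p.2.2 (K.inv_mem k.2)
  have hmul : ∀ r ∈ R, ∀ r' ∈ R, ρ (r * r') = ρ r * ρ r' := by
    intro r hr r' hr'
    obtain ⟨⟨h, k⟩, rfl⟩ := hmem r hr
    obtain ⟨⟨h', k'⟩, rfl⟩ := hmem r' hr'
    have : (h * k * (h' * k') : B) =
        (h * h' : H) * (MulAut.conjNormal (h' : B)⁻¹ k * k' : K) := by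
      simp [mul_assoc]
    simp only [this, hρ, map_mul]
  have hconj : ∀ b, ∀ r ∈ R, α b * ρ (b⁻¹ * r * b) * (α b)⁻¹ = ρ r := by
    intro b r hr
    obtain ⟨⟨h, k⟩, rfl⟩ := hmem r hr
    have : (b⁻¹ * (h * k) * b : B) =
        (MulAut.conjNormal b⁻¹ h : H) * (MulAut.conjNormal b⁻¹ k : K) := by
      simp [mul_assoc]
    simp only [this, hρ, hα]
    simp
  have hmem' : ∀ (b : B) (q : B ⧸ R), q.out⁻¹ * b * ((b : B ⧸ R)⁻¹ * q).out ∈ R := by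
    intro b q
    rw [← QuotientGroup.eq_one_iff]
    simp
  refine ⟨fun b q => α q.out * ρ (q.out⁻¹ * b * ((b : B ⧸ R)⁻¹ * q).out) *
    (α ((b : B ⧸ R)⁻¹ * q).out)⁻¹, ?_, ?_⟩
  · intro b b' q
    have := hmul _ (hmem' b q) _ (hmem' b' ((b : B ⧸ R)⁻¹ * q))
    simp only [mul_assoc, mul_inv_cancel_left, inv_mul_cancel_left, QuotientGroup.mk_mul,
      mul_inv_rev] at this ⊢
    rw [this]
    simp only [mul_assoc]
  · intro h k q
    have hr : (h * k : B) ∈ R := by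
      rw [hR]
      exact mul_mem (le_sup_left (a := H) h.2) (le_sup_right (a := H) k.2)
    have h1 : ((h * k : B) : B ⧸ R) = 1 := (QuotientGroup.eq_one_iff _).2 hr
    simp only [h1, inv_one, one_mul]
    rw [hconj _ _ hr, hρ]

end Cocycle

variable {B : Type u} [Group B] {H K : Subgroup B} {φ : H ≃* K}

theorem IsRestrictionToL.mem_iff {ψ : MulAut ↥(H ⊓ K)} (hψ : IsRestrictionToL H K φ ψ) (x : H) :
    (x : B) ∈ K ↔ (φ x : B) ∈ H := by
  constructor
  · intro hx
    have := hψ ⟨x, x.2, hx⟩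
    rw [← this]
    exact (ψ _).2.1
  · intro hx
    have := hψ (ψ.symm ⟨φ x, hx, (φ x).2⟩)
    rw [MulEquiv.apply_symm_apply] at this
    rw [φ.injective (Subtype.ext this)]
    exact (ψ.symm _).2.2

/-- A group of the class that contains `H / (H ⊓ K)` and in which the conjugations by the elements
of `B` on `H` and, through `φ`, on `K` are induced by inner automorphisms. -/
theorem exists_equivariant_hom {C : GroupClass.{u}} (hC : IsRootClass C) (hquot : QuotClosed C)
    [hH : H.Normal] [hK : K.Normal] {ψ : MulAut ↥(H ⊓ K)} (hψ : IsRestrictionToL H K φ ψ)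
    (hCH : C H) (hU : C (frakU H K φ)) :
    ∃ (D : Type u) (_ : Group D) (η : H →* D) (α β : B →* D), C D ∧
      (∀ h : H, η h = 1 ↔ (h : B) ∈ K) ∧
      (∀ b h, α b * η h * (α b)⁻¹ = η (MulAut.conjNormal b h)) ∧
      ∀ b k, β b * η (φ.symm k) * (β b)⁻¹ = η (φ.symm (MulAut.conjNormal b k)) := by
  let S : Subgroup (MulAut H) :=
    { carrier := {α | ∀ x : H, ((α x : H) : B) ∈ K ↔ (x : B) ∈ K}
      one_mem' := fun x => Iff.rfl
      mul_mem' := fun {α β} ha hb x => (ha (β x)).trans (hb x)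
      inv_mem' := fun {α} ha x => by
        rw [← ha, MulAut.apply_inv_self] }
  have hS : frakU H K φ ≤ S := by
    refine sup_le ?_ ?_
    · rintro α ⟨b, hb⟩ x
      rw [hb, ← hK.mem_comm_iff, inv_mul_cancel_left]
    · rintro _ ⟨α, ⟨b, hb⟩, rfl⟩ x
      change ((φ.symm (α (φ x)) : H) : B) ∈ K ↔ _
      rw [hψ.mem_iff, MulEquiv.apply_symm_apply, hb, ← hH.mem_comm_iff, inv_mul_cancel_left,
        hψ.mem_iff]
  let N : Subgroup (H ⋊[(frakU H K φ).subtype] frakU H K φ) :=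
    (K.subgroupOf H).map SemidirectProduct.inl
  have hN : N.Normal := by
    refine ⟨?_⟩
    rintro _ ⟨x, hx, rfl⟩ s
    refine ⟨s.left * s.right.1 x * s.left⁻¹, ?_, ?_⟩
    · have := (hS s.right.2 x).2 hx
      change (s.left * s.right.1 x * s.left⁻¹ : B) ∈ K
      exact hK.conj_mem _ this _
    · ext <;> simp
  have hl : ∀ b, MulAut.conjNormal b ∈ frakU H K φ := fun b =>
    (le_sup_left : _ ≤ frakU H K φ) ⟨b, fun y => by simp⟩
  have hr : ∀ b, autConjHom φ (MulAut.conjNormal b) ∈ frakU H K φ := fun b =>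
    (le_sup_right : _ ≤ frakU H K φ) ⟨_, ⟨b, fun y => by simp⟩, rfl⟩
  have hmk : ∀ u h, QuotientGroup.mk' N (SemidirectProduct.inr u) *
      QuotientGroup.mk' N (SemidirectProduct.inl h) *
      (QuotientGroup.mk' N (SemidirectProduct.inr u))⁻¹ =
      QuotientGroup.mk' N (SemidirectProduct.inl (u.1 h)) := by
    intro u h
    rw [← map_inv (QuotientGroup.mk' N), ← map_mul, ← map_mul, ← map_inv,
      ← SemidirectProduct.inl_aut]
    rfl
  refine ⟨_ ⧸ N, inferInstance, (QuotientGroup.mk' N).comp SemidirectProduct.inl,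
    (QuotientGroup.mk' N).comp (SemidirectProduct.inr.comp
      ((MulAut.conjNormal (H := H)).codRestrict _ hl)),
    (QuotientGroup.mk' N).comp (SemidirectProduct.inr.comp
      (((autConjHom φ).comp (MulAut.conjNormal (H := K))).codRestrict _ hr)),
    hquot _ N (hC.semidirect _ hCH hU), ?_, ?_, ?_⟩
  · intro h
    rw [MonoidHom.comp_apply, QuotientGroup.mk'_apply, QuotientGroup.eq_one_iff]
    exact Subgroup.mem_map_iff_mem SemidirectProduct.inl_injective
  · intro b h
    simp only [MonoidHom.comp_apply]
    rw [hmk]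
    rfl
  · intro b k
    simp only [MonoidHom.comp_apply]
    rw [hmk]
    congr 2
    change φ.symm (MulAut.conjNormal b (φ (φ.symm k))) = _
    rw [MulEquiv.apply_symm_apply]

/-- The HNN-extension has a homomorphism into a group of the class whose kernel meets the base group
in the intersection of the associated subgroups. -/
theorem exists_hom_eq_one_iff_mem_inf {C : GroupClass.{u}} (hC : IsRootClass C)
    (hquot : QuotClosed C) [hH : H.Normal] [hK : K.Normal] {ψ : MulAut ↥(H ⊓ K)}
    (hψ : IsRestrictionToL H K φ ψ) (hB : C B) (hU : C (frakU H K φ)) :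
    ∃ (G : Type u) (_ : Group G) (g : HNNExtension B H K φ →* G), C G ∧
      ∀ b, g (HNNExtension.of b) = 1 ↔ b ∈ H ⊓ K := by
  classical
  obtain ⟨D, _, η, α, β, hD, hη, hα, hβ⟩ :=
    exists_equivariant_hom hC hquot hψ (hC.2.2.1 B H hB) hU
  obtain ⟨c, hc, hc'⟩ := exists_cocycle H K (H ⊔ K) rfl η (fun h hh => (hη h).2 hh) α hα
  obtain ⟨d, hd, hd'⟩ := exists_cocycle K H (H ⊔ K) (sup_comm H K) (η.comp φ.symm.toMonoidHom)
    (fun k hk => (hη _).2 ((hψ.mem_iff _).2 (by simpa using hk))) β hβ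
  have hcH : ∀ (h : H) q, c h q = η h := fun h q => by simpa using hc' h 1 q
  have hcK : ∀ (k : K) q, c k q = 1 := fun k q => by simpa using hc' 1 k q
  have hdH : ∀ (h : H) q, d h q = 1 := fun h q => by simpa using hd' 1 h q
  have hdK : ∀ (k : K) q, d k q = η (φ.symm k) := fun k q => by simpa using hd' k 1 q
  obtain ⟨P, _, hP, _⟩ := hC.2.1
  obtain ⟨τ, hτ⟩ := exists_ne (1 : P)
  let i : B →* D ≀ᵣ ((B ⧸ (H ⊔ K)) × P) := MonoidHom.mk'
    (fun b => ⟨fun x => if x.2 = 1 then c b x.1 else if x.2 = τ then d b x.1 else 1, (b, 1)⟩) (by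
      intro a b
      ext x
      · simp only [RegularWreathProduct.mul_left, Pi.mul_apply, hc, hd, Prod.inv_mk,
          Prod.fst_mul, Prod.snd_mul, inv_one, one_mul]
        split_ifs <;> simp
      · simp
      · simp)
  let g : HNNExtension B H K φ →* D ≀ᵣ ((B ⧸ (H ⊔ K)) × P) := HNNExtension.lift i ⟨1, (1, τ)⟩ (by
    intro h
    have h1 : ((h : B) : B ⧸ (H ⊔ K)) = 1 :=
      (QuotientGroup.eq_one_iff _).2 (le_sup_left (a := H) h.2)
    have h2 : ((φ h : B) : B ⧸ (H ⊔ K)) = 1 :=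
      (QuotientGroup.eq_one_iff _).2 (le_sup_right (a := H) (φ h).2)
    ext x
    · simp only [i, MonoidHom.mk'_apply, RegularWreathProduct.mul_left, Pi.mul_apply, hcH, hcK, hdH,
        hdK, Prod.snd_mul, Prod.snd_inv, Pi.one_apply, one_mul, mul_one, inv_mul_eq_one,
        MulEquiv.symm_apply_apply, ite_self]
      by_cases hx : τ = x.2
      · simp [← hx, hτ]
      · simp [hx, Ne.symm hx]
    · simp [i, h1, h2]
    · simp [i])
  refine ⟨_, inferInstance, g, hC.wreath hD (hC.prod (hquot B _ hB) hP), fun b => ?_⟩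
  have hg : g (HNNExtension.of b) = i b := by simp [g]
  rw [hg]
  constructor
  · intro hb
    have hb1 : c b 1 = 1 := by
      simpa [i] using congrFun (congrArg RegularWreathProduct.left hb) (1, 1)
    have hb2 : d b 1 = 1 := by
      simpa [i, hτ] using congrFun (congrArg RegularWreathProduct.left hb) (1, τ)
    have hbR : b ∈ H ⊔ K := by
      rw [← QuotientGroup.eq_one_iff]
      exact congrArg (fun x => x.right.1) hb
    rw [Subgroup.mem_sup_of_normal_right] at hbR
    obtain ⟨h, hh, k, hk, rfl⟩ := hbR
    have hhK : h ∈ K := (hη ⟨h, hh⟩).1 (by rw [← hc' ⟨h, hh⟩ ⟨k, hk⟩ 1, hb1])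
    have hbK : h * k ∈ K := K.mul_mem hhK hk
    have hbH := (hη _).1 ((hdK ⟨_, hbK⟩ 1).symm.trans hb2)
    rw [hψ.mem_iff, MulEquiv.apply_symm_apply] at hbH
    exact ⟨hbH, hbK⟩
  · rintro ⟨hbH, hbK⟩
    ext x
    · have h1 : c b x.1 = 1 := hcK ⟨b, hbK⟩ x.1
      have h2 : d b x.1 = 1 := hdH ⟨b, hbH⟩ x.1
      simp [i, h1, h2]
    · exact (QuotientGroup.eq_one_iff _).2 (le_sup_left (a := H) hbH)
    · rfl

/-- The conjugations by the elements of the HNN-extension on the subgroup `H ⊓ K`. -/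
theorem exists_hom_frakV [H.Normal] [K.Normal] {ψ : MulAut ↥(H ⊓ K)}
    (hψ : IsRestrictionToL H K φ ψ) :
    ∃ a : HNNExtension B H K φ →* frakV H K ψ, ∀ x (l : ↥(H ⊓ K)),
      (HNNExtension.of ((a x).1 l : B) : HNNExtension B H K φ) =
        x * HNNExtension.of (l : B) * x⁻¹ := by
  have hl : ∀ b, MulAut.conjNormal b ∈ frakV H K ψ := fun b =>
    (le_sup_left : _ ≤ frakV H K ψ) ⟨b, fun y => by simp⟩
  have hz : ψ ∈ frakV H K ψ :=
    (le_sup_right : _ ≤ frakV H K ψ) (Subgroup.mem_zpowers ψ)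
  let a : HNNExtension B H K φ →* frakV H K ψ :=
    HNNExtension.lift ((MulAut.conjNormal (H := H ⊓ K)).codRestrict _ hl) ⟨ψ, hz⟩ (by
      intro h
      ext l
      change ((ψ (MulAut.conjNormal (h : B) l) : ↥(H ⊓ K)) : B) =
        ((MulAut.conjNormal (φ h : B) (ψ l) : ↥(H ⊓ K)) : B)
      have : (⟨(MulAut.conjNormal (h : B) l : ↥(H ⊓ K)), (MulAut.conjNormal (h : B) l).2.1⟩ : H) =
          h * ⟨l, l.2.1⟩ * h⁻¹ := by
        ext
        simp
      rw [hψ, this, MulAut.conjNormal_apply, hψ]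
      simp)
  have ha : ∀ b, (a (HNNExtension.of b)).1 = MulAut.conjNormal b := fun b => by simp [a]
  have hat : (a HNNExtension.t).1 = ψ := by simp [a]
  refine ⟨a, fun x => ?_⟩
  induction x using HNNExtension.induction_on with
  | of b =>
    intro l
    rw [ha]
    simp
  | t =>
    intro l
    rw [hat, hψ, HNNExtension.equiv_eq_conj]
  | mul x y hx hy =>
    intro l
    rw [map_mul]
    change HNNExtension.of ((a x).1 ((a y).1 l) : B) = _
    rw [hx, hy]
    group
  | inv x hx =>
    intro l
    have := hx ((a x⁻¹).1 l)
    have h1 : (a x).1 ((a x⁻¹).1 l) = l := by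
      rw [map_inv]
      exact MulAut.apply_inv_self _ _ _
    rw [h1] at this
    rw [this]
    group

/-- A homomorphism into a free group splits over its range. -/
theorem exists_section_freeGroup {N Ω : Type u} [Group N] (θ : N →* FreeGroup Ω) :
    ∃ σ : θ.range →* N, ∀ y, θ (σ y) = y := by
  have : IsFreeGroup θ.range := subgroupIsFreeOfIsFree θ.range
  choose s hs using θ.rangeRestrict_surjective
  let σ : θ.range →* N := IsFreeGroup.lift fun i => s (IsFreeGroup.of i)
  have : θ.rangeRestrict.comp σ = MonoidHom.id _ := by
    refine IsFreeGroup.ext_hom fun i => ?_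
    simp [σ, hs]
  exact ⟨σ, fun y => congrArg Subtype.val (DFunLike.congr_fun this y)⟩

/-- If `𝔘` and `𝔙` lie in the class, then the HNN-extension has a homomorphism onto a group of the
class that is injective on the base group. -/
theorem exists_hom_injective {C : GroupClass.{u}} (hC : IsRootClass C)
    (hquot : QuotClosed C) [hH : H.Normal] [hK : K.Normal] {ψ : MulAut ↥(H ⊓ K)}
    (hψ : IsRestrictionToL H K φ ψ) (hB : C B) (hU : C (frakU H K φ)) (hV : C (frakV H K ψ)) :
    ∃ (G : Type u) (_ : Group G) (f : HNNExtension B H K φ →* G),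
      Function.Surjective f ∧ C G ∧ Function.Injective (f.comp HNNExtension.of) := by
  obtain ⟨G, _, g, hG, hg⟩ := exists_hom_eq_one_iff_mem_inf hC hquot hψ hB hU
  obtain ⟨Ω, θ, hθ⟩ := exists_hom_ker_freeGroup g fun b => (hg b).1
  obtain ⟨σ, hσ⟩ := exists_section_freeGroup θ
  obtain ⟨a, ha⟩ := exists_hom_frakV (φ := φ) hψ
  let s : g.ker →* g.ker := σ.comp θ.rangeRestrict
  have hs : ∀ y, θ (s y) = θ y := fun y => hσ _
  have hl : ∀ y : g.ker, ∃ l : ↥(H ⊓ K),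
      (HNNExtension.of (l : B) : HNNExtension B H K φ) = y * (s y : HNNExtension B H K φ)⁻¹ := by
    intro y
    obtain ⟨b, hb⟩ := (hθ (y * (s y)⁻¹)).1 (by rw [map_mul, map_inv, hs, mul_inv_cancel])
    refine ⟨⟨b, (hg b).1 ?_⟩, hb⟩
    rw [hb]
    exact (y * (s y)⁻¹).2
  choose l hl using hl
  have hinj : Function.Injective (HNNExtension.of : B →* HNNExtension B H K φ) :=
    HNNExtension.of_injective φ
  let π : g.ker →* ↥(H ⊓ K) ⋊[(frakV H K ψ).subtype] frakV H K ψ :=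
    MonoidHom.mk' (fun y => ⟨l y, a (s y)⟩) (by
      intro x y
      ext1
      · apply Subtype.ext
        apply hinj
        change HNNExtension.of (l (x * y) : B) = HNNExtension.of (l x * (a (s x)).1 (l y) : B)
        rw [map_mul HNNExtension.of, ha, hl, hl, hl, map_mul]
        push_cast
        group
      · simp)
  obtain ⟨T, hT, hle, hCT⟩ := hC.exists_normal_le_ker g π hG
    (hC.semidirect _ (hC.2.2.1 B _ hB) hV)
  refine ⟨_, _, QuotientGroup.mk' T, QuotientGroup.mk'_surjective T, hCT, ?_⟩
  rw [injective_iff_map_eq_one]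
  intro b hb
  obtain ⟨y, hy, hyb⟩ := hle ((QuotientGroup.eq_one_iff _).1 hb)
  have hly : l y = 1 := congrArg SemidirectProduct.left hy
  have hθy : θ y = 1 := (hθ y).2 ⟨b, hyb.symm⟩
  have hsy : s y = 1 := by
    have : θ.rangeRestrict y = 1 := Subtype.ext hθy
    simp [s, this]
  have := hl y
  rw [hly, hsy] at this
  apply hinj
  rw [← hyb, map_one]
  simpa using this.symm

end Sufficiency

theorem statement_0 (C : GroupClass.{u}) (hroot : IsRootClass C) (hquot : QuotClosed C)
    {B : Type u} [Group B] (H K : Subgroup B) (φ : H ≃* K)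
    (hH : H.Normal) (hK : K.Normal)
    (ψ : MulAut ↥(H ⊓ K)) (hψ : IsRestrictionToL H K φ ψ)
    (hB : C B) :
    ((∃ (G : Type u) (_ : Group G) (f : HNNExtension B H K φ →* G),
        Function.Surjective f ∧ C G ∧ Function.Injective (f.comp HNNExtension.of)) ↔
      (C ↥(frakU H K φ) ∧ C ↥(frakV H K ψ))) ∧
    ((C ↥(frakU H K φ) ∧ C ↥(frakV H K ψ)) →
      Residually C (HNNExtension B H K φ)) := by
  have hiff : (∃ (G : Type u) (_ : Group G) (f : HNNExtension B H K φ →* G),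
      Function.Surjective f ∧ C G ∧ Function.Injective (f.comp HNNExtension.of)) ↔
      (C ↥(frakU H K φ) ∧ C ↥(frakV H K ψ)) := by
    constructor
    · rintro ⟨G, _, f, -, hG, hf⟩
      exact ⟨frakU_of_injective hroot hquot f hG hf,
        frakV_of_injective hroot hquot f hG hf hψ⟩
    · rintro ⟨hU, hV⟩
      exact exists_hom_injective hroot hquot hψ hB hU hV
  refine ⟨hiff, fun h => ?_⟩
  obtain ⟨G, _, f, -, hG, hf⟩ := hiff.2 h
  exact hroot.residually_of_injective f hG hf
end

section
/- Suppose the HNN-extension 𝔼 = ⟨B, t; t⁻¹Ht = K, φ⟩ satisfies condition (*) and 𝒞 is a class of groups closed under taking subgroups, quotient groups, and direct products of a finite number of factors. Suppose also that at least one of the following holds: (a) 𝔘 = 𝔥 or 𝔘 = 𝔎; (b) H and K satisfy a non-trivial identity; (c) 𝔥 satisfies a non-trivial identity; (d) 𝔎 satisfies a non-trivial identity. If 𝔼 is residually a 𝒞-group, then the quotient groups B/H and B/K are residually 𝒞-groups. -/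
universe u

open Subgroup

open Pointwise

section FreeGroups

/-- If `w`, written in the letters `1, 2, …`, commutes with the letter `0`, then `w = 1`. -/
theorem FreeGroup.eq_one_of_commute_map_succ {w : FreeGroup ℕ}
    (h : Commute (FreeGroup.map Nat.succ w) (FreeGroup.of 0)) : w = 1 := by
  let θ : FreeGroup ℕ →* Equiv.Perm (FreeGroup ℕ ⊕ FreeGroup ℕ) :=
    ((Equiv.Perm.sumCongrHom _ _).comp (MonoidHom.inl _ _)).comp
      (MulAction.toPermHom (FreeGroup ℕ) (FreeGroup ℕ))
  let Φ : FreeGroup ℕ →* Equiv.Perm (FreeGroup ℕ ⊕ FreeGroup ℕ) :=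
    FreeGroup.lift fun n => Nat.casesOn n (Equiv.sumComm _ _) fun i => θ (FreeGroup.of i)
  have hΦ : Φ.comp (FreeGroup.map Nat.succ) = θ := by ext1 i; simp [Φ]
  have hw : Φ (FreeGroup.map Nat.succ w) = θ w := DFunLike.congr_fun hΦ w
  have h0 : Φ (FreeGroup.of 0) = Equiv.sumComm _ _ := by simp [Φ]
  have hc := h.map Φ
  rw [hw, h0] at hc
  have := DFunLike.congr_fun hc.eq (Sum.inr 1)
  simpa [θ] using this

/-- A free group of rank two contains a free group of countable rank. -/
theorem FreeGroup.exists_injective_nat_bool :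
    ∃ f : FreeGroup ℕ →* FreeGroup Bool, Function.Injective f := by
  let α : MulAut (FreeGroup ℤ) := FreeGroup.freeGroupCongr (Equiv.addRight 1)
  have hα : ∀ n : ℕ, (α ^ n) (FreeGroup.of 0) = FreeGroup.of (n : ℤ) := by
    intro n
    induction n with
    | zero => simp
    | succ n ih => rw [pow_succ', MulAut.mul_apply, ih]; simp [α]
  let Φ : FreeGroup Bool →* Equiv.Perm (FreeGroup ℤ) :=
    FreeGroup.lift fun i => cond i (MulAut.toPerm _ α)
      (MulAction.toPermHom (FreeGroup ℤ) (FreeGroup ℤ) (FreeGroup.of 0))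
  let f : FreeGroup ℕ →* FreeGroup Bool := FreeGroup.lift fun n =>
    FreeGroup.of true ^ n * FreeGroup.of false * (FreeGroup.of true ^ n)⁻¹
  have hf : Φ.comp f = (MulAction.toPermHom (FreeGroup ℤ) (FreeGroup ℤ)).comp
      (FreeGroup.map ((↑) : ℕ → ℤ)) := by
    ext1 n
    have ha : Φ (FreeGroup.of true) = MulAut.toPerm _ α := by simp [Φ]
    have hb : Φ (FreeGroup.of false) = MulAction.toPermHom (FreeGroup ℤ) (FreeGroup ℤ) (FreeGroup.of 0) := by simp [Φ]
    have hfn : Φ (f (FreeGroup.of n)) = MulAut.toPerm _ (α ^ n) *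
        MulAction.toPermHom (FreeGroup ℤ) (FreeGroup ℤ) (FreeGroup.of 0) * (MulAut.toPerm _ (α ^ n))⁻¹ := by
      rw [FreeGroup.lift_apply_of]
      simp only [_root_.map_mul, _root_.map_pow, _root_.map_inv, ha, hb]
    ext1 x
    rw [MonoidHom.comp_apply, MonoidHom.comp_apply, FreeGroup.map.of, ← hα, hfn, ← _root_.map_inv]
    change (α ^ n) (FreeGroup.of 0 * (α ^ n)⁻¹ x) = (α ^ n) (FreeGroup.of 0) * x
    rw [_root_.map_mul, MulAut.apply_inv_self]
  refine ⟨f, Function.Injective.of_comp (f := Φ) ?_⟩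
  rw [← MonoidHom.coe_comp, hf, MonoidHom.coe_comp]
  exact MulAction.toPerm_injective.comp (FreeGroup.map_injective Nat.cast_injective)

end FreeGroups

section PingPong

variable {G : Type*} [Group G]

/-- Left multiplication by `a` and by `a⁻¹` both move the complement of `S` into `S`. -/
def Attracts (a : G) (S : Set G) : Prop := ∀ g ∉ S, a * g ∈ S ∧ a⁻¹ * g ∈ S

theorem Attracts.conj {a : G} {S : Set G} (h : Attracts a S) (x : G) :
    Attracts (x * a * x⁻¹) (x • S) := by
  intro g hg
  rw [Set.mem_smul_set_iff_inv_smul_mem, smul_eq_mul] at hg ⊢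
  rw [Set.mem_smul_set_iff_inv_smul_mem, smul_eq_mul]
  convert! h _ hg using 2 <;> group

theorem Attracts.nonempty {a : G} {S : Set G} (h : Attracts a S) : S.Nonempty := by
  by_cases h1 : (1 : G) ∈ S
  exacts [⟨1, h1⟩, ⟨_, (h 1 h1).1⟩]

theorem exists_injective_freeGroup_of_attracts {G : Type u} [Group G] {a b c : G} {X Y Z : Set G}
    (ha : Attracts a X) (hb : Attracts b Y) (hc : Attracts c Z)
    (hXY : Disjoint X Y) (hXZ : Disjoint X Z) (hYZ : Disjoint Y Z)
    (T : Subgroup G) (haT : a ∈ T) (hbT : b ∈ T) (hcT : c ∈ T) :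
    ∃ f : FreeGroup ℕ →* G, Function.Injective f ∧ ∀ w, f w ∈ T := by
  have hcZ : ∀ {S : Set G}, Disjoint S Z → c • S ⊆ Z := by
    rintro S hS _ ⟨g, hg, rfl⟩
    exact (hc g (Set.disjoint_left.1 hS hg)).1
  have key : ∀ g ∉ Y, a * b * g ∈ X := fun g hg => by
    rw [mul_assoc]
    exact (ha _ (Set.disjoint_right.1 hXY (hb g hg).1)).1
  have key' : ∀ g ∉ X, (a * b)⁻¹ * g ∈ Y := fun g hg => by
    rw [mul_inv_rev, mul_assoc]
    exact (hb _ (Set.disjoint_left.1 hXY (ha g hg).2)).2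
  let p : ULift.{u} Bool → G := fun i => cond i.down (a * b) (c * (a * b) * c⁻¹)
  let U : ULift.{u} Bool → Set G := fun i => cond i.down X (c • X)
  let V : ULift.{u} Bool → Set G := fun i => cond i.down Y (c • Y)
  have hdisj : Disjoint (c • X) (c • Y) := by
    rwa [Set.disjoint_smul_set]
  have hp : Function.Injective (FreeGroup.lift p) := by
    apply FreeGroup.injective_lift_of_ping_pong p U V
    · rintro ⟨_ | _⟩
      exacts [ha.nonempty.smul_set, ha.nonempty]
    · rintro ⟨_ | _⟩ ⟨_ | _⟩ hij
      · exact absurd rfl hij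
      · exact (hXZ.mono_right (hcZ hXZ)).symm
      · exact hXZ.mono_right (hcZ hXZ)
      · exact absurd rfl hij
    · rintro ⟨_ | _⟩ ⟨_ | _⟩ hij
      · exact absurd rfl hij
      · exact (hYZ.mono_right (hcZ hYZ)).symm
      · exact hYZ.mono_right (hcZ hYZ)
      · exact absurd rfl hij
    · rintro ⟨_ | _⟩ ⟨_ | _⟩
      · exact hdisj
      · exact (hYZ.mono_right (hcZ hXZ)).symm
      · exact hXZ.mono_right (hcZ hYZ)
      · exact hXY
    · rintro ⟨_ | _⟩ _ ⟨g, hg, rfl⟩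
      · refine ⟨a * b * (c⁻¹ * g), key _ fun h => hg ?_, ?_⟩
        · exact Set.mem_smul_set_iff_inv_smul_mem.2 h
        · simp [p, mul_assoc]
      · exact key g hg
    · rintro ⟨_ | _⟩ _ ⟨g, hg, rfl⟩
      · refine ⟨(a * b)⁻¹ * (c⁻¹ * g), key' _ fun h => hg ?_, ?_⟩
        · exact Set.mem_smul_set_iff_inv_smul_mem.2 h
        · simp [p, mul_assoc]
      · exact key' g hg
  obtain ⟨f, hf⟩ := FreeGroup.exists_injective_nat_bool
  refine ⟨(FreeGroup.lift p).comp ((FreeGroup.map ULift.up).comp f),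
    hp.comp ((FreeGroup.map_injective ULift.up_injective).comp hf), fun w => ?_⟩
  have hab := T.mul_mem haT hbT
  have : (FreeGroup.lift p).range ≤ T := by
    refine FreeGroup.range_lift_le ?_
    rintro _ ⟨⟨_ | _⟩, rfl⟩
    exacts [T.mul_mem (T.mul_mem hcT hab) (T.inv_mem hcT), hab]
  exact this ⟨FreeGroup.map ULift.up (f w), rfl⟩

end PingPong

namespace HNNExtension

open NormalWord

section StartsWith

variable {G : Type*} [Group G] {A B : Subgroup G} (φ : A ≃* B)

/-- The elements represented by a reduced word that begins with the letter `t ^ u`. -/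
def startsWith (u : ℤˣ) : Set (HNNExtension G A B φ) :=
  {g | ∃ w : ReducedWord G A B, w.prod φ = g ∧ w.head = 1 ∧ u ∈ w.toList.head?.map Prod.fst}

variable {φ}

theorem eq_and_mem_of_of_mul_mem_startsWith {u v : ℤˣ} {b : G} {g : HNNExtension G A B φ}
    (hg : g ∈ startsWith φ u) (hbg : of b * g ∈ startsWith φ v) :
    u = v ∧ b ∈ toSubgroup A B (-u) := by
  obtain ⟨w₁, rfl, h₁, hu⟩ := hg
  obtain ⟨w₂, hw, h₂, hv⟩ := hbg
  have hprod : ReducedWord.prod φ ⟨b, w₁.toList, w₁.chain⟩ = w₂.prod φ := by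
    rw [hw]; simp [ReducedWord.prod, h₁]
  obtain ⟨h, h'⟩ := ReducedWord.map_fst_eq_and_of_prod_eq φ hprod
  refine ⟨?_, by simpa [h₂] using h' u hu⟩
  rw [← List.head?_map] at hu hv
  rw [← h] at hv
  rw [List.head?_map] at hu hv
  exact Option.mem_unique hu hv

theorem of_notMem_startsWith (b : G) (u : ℤˣ) :
    (of b : HNNExtension G A B φ) ∉ startsWith φ u := by
  rintro ⟨w, hw, -, hu⟩
  simp [ReducedWord.toList_eq_nil_of_mem_of_range φ w ⟨b, hw.symm⟩] at hu

theorem t_zpow_mul_of_mul_mem_startsWith {u v : ℤˣ} {b : G} {g : HNNExtension G A B φ}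
    (hb : b ∉ toSubgroup A B v) (hg : g ∈ startsWith φ u) :
    t ^ (v : ℤ) * (of b * g) ∈ startsWith φ v := by
  obtain ⟨w, rfl, h, -⟩ := hg
  refine ⟨⟨1, (v, b) :: w.toList, List.isChain_cons.2 ⟨fun _ _ h' => absurd h' hb, w.chain⟩⟩,
    ?_, rfl, by simp⟩
  simp [ReducedWord.prod, h, mul_assoc]

theorem of_mul_t_zpow (u : ℤˣ) (a : toSubgroup A B (-u)) :
    ∃ a' : toSubgroup A B u,
      (of (a : G) : HNNExtension G A B φ) * t ^ (u : ℤ) = t ^ (u : ℤ) * of (a' : G) := by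
  rcases Int.units_eq_one_or u with rfl | rfl
  · exact ⟨φ.symm a, by simpa using of_mul_t (φ := φ) a⟩
  · exact ⟨φ a, by simpa using of_mul_inv_t (φ := φ) a⟩

theorem t_zpow_mul_mem_startsWith {u : ℤˣ} {g : HNNExtension G A B φ}
    (hg : g ∉ startsWith φ u) : t ^ (-(u : ℤ)) * g ∈ startsWith φ (-u) := by
  obtain ⟨d⟩ := TransversalPair.nonempty G A B
  obtain ⟨⟨⟨b, l, hl⟩, _⟩, rfl⟩ := (NormalWord.equiv φ d).symm.surjective g
  change ReducedWord.prod φ ⟨b, l, hl⟩ ∉ _ at hg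
  change _ * ReducedWord.prod φ ⟨b, l, hl⟩ ∈ _
  refine ⟨⟨1, (-u, b) :: l, List.isChain_cons.2 ⟨?_, hl⟩⟩, ?_, rfl, by simp⟩
  · rintro ⟨v, c⟩ hv hb
    by_contra! hne
    have huv : v = u := by
      rcases Int.units_eq_one_or u with rfl | rfl <;>
        rcases Int.units_eq_one_or v with rfl | rfl <;> simp_all
    subst huv
    obtain ⟨a', ha'⟩ := of_mul_t_zpow (φ := φ) v ⟨b, hb⟩
    cases l with
    | nil => simp at hv
    | cons p l =>
      obtain rfl : p = (v, c) := by simpa using hv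
      refine hg ⟨⟨1, (v, a' * c) :: l, List.isChain_cons.2 ⟨fun q hq h => ?_,
        (List.isChain_cons.1 hl).2⟩⟩, ?_, rfl, by simp⟩
      · exact (List.isChain_cons.1 hl).1 q hq ((Subgroup.mul_mem_cancel_left _ a'.2).1 h)
      · simp only [ReducedWord.prod, List.map_cons, List.prod_cons, map_one, one_mul, map_mul]
        simp only [← mul_assoc, ha']
  · simp [ReducedWord.prod, mul_assoc]

theorem attracts_startsWith {v : ℤˣ} {x : G} (hx : x ∉ toSubgroup A B v) :
    Attracts (t ^ (v : ℤ) * of x * t ^ (-(v : ℤ)) : HNNExtension G A B φ) (startsWith φ v) := by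
  have key : ∀ y ∉ toSubgroup A B v, ∀ g ∉ startsWith φ v,
      (t ^ (v : ℤ) * of y * t ^ (-(v : ℤ)) : HNNExtension G A B φ) * g ∈ startsWith φ v := by
    intro y hy g hg
    simpa only [mul_assoc] using
      t_zpow_mul_of_mul_mem_startsWith hy (t_zpow_mul_mem_startsWith hg)
  intro g hg
  refine ⟨key x hx g hg, ?_⟩
  convert! key x⁻¹ (by simpa using hx) g hg using 2
  simp [mul_assoc]

end StartsWith

/-- Replacing the stable letter by its inverse swaps the associated subgroups. -/
def swapEquiv {G : Type*} [Group G] {A B : Subgroup G} (φ : A ≃* B) :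
    HNNExtension G A B φ ≃* HNNExtension G B A φ.symm :=
  MonoidHom.toMulEquiv
    (lift of t⁻¹ fun a => by rw [inv_t_mul_of]; rfl)
    (lift of t⁻¹ fun b => by rw [inv_t_mul_of])
    (by ext <;> simp) (by ext <;> simp)

end HNNExtension

section ResidualClosure

theorem Residually.of_mulEquiv {C : GroupClass.{u}} {X Y : Type u} [Group X] [Group Y]
    (e : X ≃* Y) (h : Residually C X) : Residually C Y := by
  intro y hy
  obtain ⟨G, _, f, hf, hG, hfy⟩ := h (e.symm y) (by simpa using hy)
  exact ⟨G, _, f.comp e.symm.toMonoidHom, hf.comp e.symm.surjective, hG, hfy⟩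

variable (C : GroupClass.{u}) {E : Type u} [Group E]

/-- The closure of a subgroup in the pro-`C` topology: the elements that every homomorphism
onto a `C`-group maps into the image of the subgroup. -/
def residualClosure (S : Subgroup E) : Subgroup E where
  carrier := {g | ∀ (G : Type u) [Group G] (f : E →* G), Function.Surjective f → C G →
    f g ∈ S.map f}
  one_mem' G _ f _ _ := by rw [map_one]; exact one_mem _
  mul_mem' ha hb G _ f hf hG := by rw [map_mul]; exact mul_mem (ha G f hf hG) (hb G f hf hG)
  inv_mem' ha G _ f hf hG := by rw [map_inv]; exact inv_mem (ha G f hf hG)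

variable {C}

theorem mem_residualClosure {S : Subgroup E} {g : E} :
    g ∈ residualClosure C S ↔ ∀ (G : Type u) [Group G] (f : E →* G), Function.Surjective f →
      C G → ∃ s ∈ S, f s = f g := Iff.rfl

theorem le_residualClosure (S : Subgroup E) : S ≤ residualClosure C S :=
  fun g hg _ _ _ _ _ => ⟨g, hg, rfl⟩

theorem conj_mem_residualClosure {S S' : Subgroup E} {g z : E}
    (hg : ∀ s ∈ S, g * s * g⁻¹ ∈ S') (hz : z ∈ residualClosure C S) :
    g * z * g⁻¹ ∈ residualClosure C S' := by
  rw [mem_residualClosure] at hz ⊢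
  intro G _ f hf hG
  obtain ⟨s, hs, hfs⟩ := hz G f hf hG
  exact ⟨_, hg s hs, by simp [hfs]⟩

theorem conj_mem_residualClosure_of_mem {S T : Subgroup E} {g z : E}
    (hT : ∀ k ∈ T, ∀ s ∈ S, k * s * k⁻¹ ∈ S) (hg : g ∈ residualClosure C T)
    (hz : z ∈ residualClosure C S) : g * z * g⁻¹ ∈ residualClosure C S := by
  rw [mem_residualClosure] at hz hg ⊢
  intro G _ f hf hG
  obtain ⟨s, hs, hfs⟩ := hz G f hf hG
  obtain ⟨k, hk, hfk⟩ := hg G f hf hG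
  exact ⟨_, hT k hk s hs, by simp [hfs, hfk]⟩

theorem Residually.eq_of_forall_map_eq (hres : Residually C E) {x y : E}
    (h : ∀ (G : Type u) [Group G] (f : E →* G), Function.Surjective f → C G → f x = f y) :
    x = y := by
  by_contra hne
  obtain ⟨G, _, f, hf, hG, hfx⟩ := hres (x * y⁻¹) (by rwa [Ne, mul_inv_eq_one])
  exact hfx (by rw [map_mul, map_inv, h G f hf hG, mul_inv_cancel])

theorem Residually.commute_of_mem_residualClosure (hres : Residually C E) {S : Subgroup E} {x z : E}
    (hx : ∀ s ∈ S, Commute x s) (hz : z ∈ residualClosure C S) : Commute x z := by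
  refine hres.eq_of_forall_map_eq fun G _ f hf hG => ?_
  obtain ⟨s, hs, hfs⟩ := mem_residualClosure.1 hz G f hf hG
  simpa [hfs] using congrArg f (hx s hs).eq

/-- If all values of the word `w` on `S` are central in `S`, the same holds for the closure. -/
theorem Residually.commute_word_residualClosure (hres : Residually C E) {S : Subgroup E}
    {w : FreeGroup ℕ} (hw : ∀ f : FreeGroup ℕ →* E, (∀ v, f v ∈ S) → ∀ s ∈ S, Commute (f w) s)
    (f : FreeGroup ℕ →* E) (hf : ∀ v, f v ∈ residualClosure C S) {z : E}
    (hz : z ∈ residualClosure C S) : Commute (f w) z := by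
  refine hres.eq_of_forall_map_eq fun G _ σ hσ hG => ?_
  obtain ⟨s, hs, hfs⟩ := mem_residualClosure.1 hz G σ hσ hG
  choose a ha haf using fun i => mem_residualClosure.1 (hf (FreeGroup.of i)) G σ hσ hG
  let g : FreeGroup ℕ →* E := FreeGroup.lift a
  have hg : ∀ v, g v ∈ S := fun v => by
    have : g.range ≤ S := by
      refine FreeGroup.range_lift_le ?_
      rintro _ ⟨i, rfl⟩
      exact ha i
    exact this ⟨v, rfl⟩
  have hgf : σ.comp g = σ.comp f := by ext i; simp [g, haf]
  have hgw : σ (g w) = σ (f w) := DFunLike.congr_fun hgf w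
  simpa [hfs, hgw] using congrArg σ (hw g hg s hs).eq

end ResidualClosure

/-- Some non-trivial word takes only central values on `G`. -/
def HasCentralWord (G : Type*) [Group G] : Prop :=
  ∃ w : FreeGroup ℕ, w ≠ 1 ∧ ∀ (f : FreeGroup ℕ →* G) (g : G), Commute (f w) g

theorem SatisfiesNontrivialIdentity.hasCentralWord {G : Type u} [Group G]
    (h : SatisfiesNontrivialIdentity G) : HasCentralWord G := by
  obtain ⟨w, hw, hf⟩ := h
  exact ⟨w, hw, fun f g => by rw [hf]; exact Commute.one_left g⟩

theorem HasCentralWord.of_mulEquiv {G G' : Type*} [Group G] [Group G'] (e : G ≃* G')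
    (h : HasCentralWord G) : HasCentralWord G' := by
  obtain ⟨w, hw, hf⟩ := h
  refine ⟨w, hw, fun f g => ?_⟩
  simpa using (hf (e.symm.toMonoidHom.comp f) (e.symm g)).map e

/-- If a group of automorphisms containing all inner ones satisfies an identity, then the
corresponding word takes only central values. -/
theorem hasCentralWord_of_conj_mem {G : Type u} [Group G] {M : Subgroup (MulAut G)}
    (hM : ∀ g, MulAut.conj g ∈ M) (h : SatisfiesNontrivialIdentity M) : HasCentralWord G := by
  obtain ⟨w, hw, hf⟩ := h
  refine ⟨w, hw, fun f g => ?_⟩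
  have h1 := congrArg (fun m : M => (m : MulAut G) g)
    (hf ((MulAut.conj.codRestrict M hM).comp f))
  have h2 : f w * g * (f w)⁻¹ = g := by simpa using h1
  exact mul_inv_eq_iff_eq_mul.1 h2

section Core

variable {C : GroupClass.{u}} {B : Type u} [Group B] {H K : Subgroup B} {φ : H ≃* K}

theorem mem_iff_of_phiInvL (hinv : PhiInvL H K φ) (h : H) : (h : B) ∈ K ↔ (φ h : B) ∈ H := by
  have := SetLike.ext_iff.1 hinv (φ h)
  simpa [Subgroup.mem_subgroupOf] using this

/-- If `ι b` lies in the closure of `H.map ι` only for `b ∈ H`, then `B ⧸ H` is residually a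
`C`-group. -/
theorem residually_quotient_of_residualClosure (hsub : SubgroupClosed C) (hquot : QuotClosed C)
    [H.Normal] {E : Type u} [Group E] (ι : B →* E)
    (h : ∀ b, ι b ∈ residualClosure C (H.map ι) → b ∈ H) : Residually C (B ⧸ H) := by
  intro x hx
  obtain ⟨b, rfl⟩ := QuotientGroup.mk_surjective x
  have hb : b ∉ H := fun hb => hx ((QuotientGroup.eq_one_iff b).2 hb)
  have hb' := mt (h b) hb
  rw [mem_residualClosure] at hb'
  push Not at hb'
  obtain ⟨G, _, f, hf, hG, hfb⟩ := hb'
  let ρ : B →* (f.comp ι).range := (f.comp ι).rangeRestrict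
  have hρ : Function.Surjective ρ := (f.comp ι).rangeRestrict_surjective
  have hN : (H.map ρ).Normal := Subgroup.Normal.map inferInstance ρ hρ
  refine ⟨_ ⧸ H.map ρ, inferInstance, QuotientGroup.map H (H.map ρ) ρ (Subgroup.le_comap_map _ _),
    ?_, hquot _ _ (hsub _ _ hG), ?_⟩
  · exact QuotientGroup.map_surjective_of_surjective _ _ _
      ((QuotientGroup.mk_surjective).comp hρ) _
  · intro h1
    rw [QuotientGroup.map_mk, QuotientGroup.eq_one_iff] at h1
    obtain ⟨s, hs, hsb⟩ := h1
    exact hfb (ι s) ⟨s, hs, rfl⟩ (congrArg Subtype.val hsb)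

open HNNExtension in
theorem mem_of_mem_residualClosure (hH : H.Normal) (hK : K.Normal)
    (hinv : ∀ h : H, (h : B) ∈ K ↔ (φ h : B) ∈ H)
    (hcase : HasCentralWord H ∨
      (∀ x : B, ∃ y : B, ∀ h : H, (φ ⟨y * h * y⁻¹, hH.conj_mem h h.2 y⟩ : B) = x * φ h * x⁻¹) ∨
      (∀ x : B, ∃ y : B, ∀ h : H, (φ ⟨x * h * x⁻¹, hH.conj_mem h h.2 x⟩ : B) = y * φ h * y⁻¹))
    (hres : Residually C (HNNExtension B H K φ)) {b : B}
    (hb : (of b : HNNExtension B H K φ) ∈ residualClosure C (H.map of)) : b ∈ H := by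
  by_contra hbH
  obtain ⟨x, hx⟩ : ∃ x, x ∉ K := by
    by_contra! hall
    exact hbH (by simpa using (hinv (φ.symm ⟨b, hall b⟩)).1 (hall _))
  have hof : ∀ (S : Subgroup B), S.Normal → ∀ y : B, ∀ s ∈ S.map (of (φ := φ)),
      of y * s * (of y)⁻¹ ∈ S.map (of (φ := φ)) := by
    rintro S hS y _ ⟨s, hs, rfl⟩
    exact ⟨y * s * y⁻¹, hS.conj_mem s hs y, by simp⟩
  have ht : ∀ s ∈ H.map (of (φ := φ)), t * s * t⁻¹ ∈ K.map (of (φ := φ)) := by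
    rintro _ ⟨s, hs, rfl⟩
    exact ⟨φ ⟨s, hs⟩, (φ ⟨s, hs⟩).2, equiv_eq_conj (φ := φ) ⟨s, hs⟩⟩
  have ht' : ∀ s ∈ K.map (of (φ := φ)), t⁻¹ * s * t ∈ H.map (of (φ := φ)) := by
    rintro _ ⟨s, hs, rfl⟩
    exact ⟨φ.symm ⟨s, hs⟩, (φ.symm ⟨s, hs⟩).2, equiv_symm_eq_conj (φ := φ) ⟨s, hs⟩⟩
  set r : HNNExtension B H K φ := t⁻¹ * of x * t with hr
  have hrS : ∀ s ∈ H.map (of (φ := φ)), r * s * r⁻¹ ∈ H.map (of (φ := φ)) := by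
    intro s hs
    convert! ht' _ (hof K hK x _ (ht s hs)) using 1
    simp [hr, mul_assoc]
  have hattr : ∀ a ∉ H, Attracts (t * of a * t⁻¹ : HNNExtension B H K φ) (startsWith φ 1) := by
    intro a ha
    simpa using attracts_startsWith (φ := φ) (v := 1) ha
  have hattr_r : Attracts r (startsWith φ (-1)) := by
    simpa using attracts_startsWith (φ := φ) (v := -1) hx
  have hsubset : ((t⁻¹ * of x : HNNExtension B H K φ) • startsWith φ 1) ⊆ startsWith φ (-1) := by
    rintro _ ⟨g, hg, rfl⟩
    simpa [mul_assoc] using t_zpow_mul_of_mul_mem_startsWith (φ := φ) (v := -1) hx hg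
  have hrconj : ∀ a : B, r * of a * r⁻¹ =
      (t⁻¹ * of x) * (t * of a * t⁻¹) * (t⁻¹ * of x)⁻¹ := by
    intro a; simp [hr, mul_assoc]
  have hattr_rar : ∀ a ∉ H, Attracts (r * of a * r⁻¹)
      ((t⁻¹ * of x : HNNExtension B H K φ) • startsWith φ 1) := by
    intro a ha
    rw [hrconj]
    exact (hattr a ha).conj _
  rcases hcase with ⟨w, hw, hwH⟩ | hxy | hxy
  · set c : HNNExtension B H K φ := t * of b * t⁻¹ with hc
    set d : HNNExtension B H K φ := r * of b * r⁻¹ with hd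
    set D := (t⁻¹ * of x : HNNExtension B H K φ) • startsWith φ 1
    have hdS : d ∈ residualClosure C (H.map of) := conj_mem_residualClosure hrS hb
    have hcK : c ∈ residualClosure C (K.map of) := conj_mem_residualClosure ht hb
    have hbd : of b * d * (of b)⁻¹ ∈ residualClosure C (H.map of) :=
      conj_mem_residualClosure (hof H hH b) hdS
    have hcd : c * d * c⁻¹ ∈ residualClosure C (H.map of) := by
      refine conj_mem_residualClosure_of_mem ?_ hcK hdS
      rintro _ ⟨k, -, rfl⟩
      exact hof H hH k
    have hD : Attracts d D := hattr_rar b hbH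
    have hcD : c • D ⊆ startsWith φ 1 := by
      rintro _ ⟨g, hg, rfl⟩
      refine (hattr b hbH g fun h => ?_).1
      exact absurd (eq_and_mem_of_of_mul_mem_startsWith (b := 1) h
        (by simpa using hsubset hg)).1 (by decide)
    obtain ⟨f, hf, hfS⟩ := exists_injective_freeGroup_of_attracts hD (hD.conj (of b)) (hD.conj c)
      (by
        rw [Set.disjoint_left]
        rintro _ hg ⟨g, hg', rfl⟩
        exact hbH (eq_and_mem_of_of_mul_mem_startsWith (hsubset hg') (hsubset hg)).2)
      (by
        rw [Set.disjoint_left]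
        intro g hg hg'
        exact absurd (eq_and_mem_of_of_mul_mem_startsWith (b := 1) (hcD hg')
          (by simpa using hsubset hg)).1 (by decide))
      (by
        rw [Set.disjoint_left]
        rintro _ ⟨g, hg, rfl⟩ hg'
        exact absurd (eq_and_mem_of_of_mul_mem_startsWith (hsubset hg) (hcD hg')).1 (by decide))
      _ hdS hbd hcd
    have hwS : ∀ f : FreeGroup ℕ →* HNNExtension B H K φ, (∀ v, f v ∈ H.map of) →
        ∀ s ∈ H.map (of (φ := φ)), Commute (f w) s := by
      intro f hf s hs
      let e := (H.equivMapOfInjective _ (of_injective (φ := φ)))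
      have := (hwH (e.symm.toMonoidHom.comp (f.codRestrict _ hf)) (e.symm ⟨s, hs⟩)).map e
      simpa [Commute, SemiconjBy] using congrArg Subtype.val this.eq
    have hcomm := hres.commute_word_residualClosure hwS (f.comp (FreeGroup.map Nat.succ))
      (fun v => hfS _) (hfS (FreeGroup.of 0))
    refine hw (FreeGroup.eq_one_of_commute_map_succ (hf ?_))
    simpa using hcomm.eq
  · obtain ⟨y, hy⟩ := hxy x
    have hcomm : Commute ((of y)⁻¹ * r) (of b) := by
      refine hres.commute_of_mem_residualClosure ?_ hb
      rintro _ ⟨h, hh, rfl⟩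
      have h1 := congrArg (of (φ := φ)) (hy ⟨h, hh⟩)
      simp only [equiv_eq_conj, map_mul, map_inv] at h1
      have h2 : r * of h * r⁻¹ = of y * of h * (of y)⁻¹ := by
        have := congrArg (fun z => t⁻¹ * z * t) h1
        simpa [hr, mul_assoc] using this.symm
      rw [mul_inv_eq_iff_eq_mul] at h2
      change _ * _ = _ * _
      rw [mul_assoc, h2]
      group
    have h1 : r * of b ∈ startsWith φ (-1) := (hattr_r _ (of_notMem_startsWith _ _)).1
    have h2 : r ∈ startsWith φ (-1) := by
      simpa using (hattr_r (of 1) (of_notMem_startsWith _ _)).1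
    have h3 : of (y * b * y⁻¹) * r ∈ startsWith φ (-1) := by
      convert! h1 using 1
      have := hcomm.eq
      rw [mul_assoc, inv_mul_eq_iff_eq_mul] at this
      simp [this, mul_assoc]
    have h4 : y * b * y⁻¹ ∈ H := (eq_and_mem_of_of_mul_mem_startsWith h2 h3).2
    exact hbH (by simpa [mul_assoc] using hH.conj_mem _ h4 y⁻¹)
  · obtain ⟨y, hy⟩ := hxy b
    set c : HNNExtension B H K φ := t * of b * t⁻¹ with hc
    have hcK : c ∈ residualClosure C (K.map of) := conj_mem_residualClosure ht hb
    have hyc : Commute ((of y)⁻¹ * c) c := by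
      refine hres.commute_of_mem_residualClosure ?_ hcK
      rintro _ ⟨k, hk, rfl⟩
      obtain ⟨h, rfl⟩ : ∃ h, k = φ h := ⟨φ.symm ⟨k, hk⟩, by simp⟩
      have h1 := congrArg (of (φ := φ)) (hy h)
      simp only [equiv_eq_conj, map_mul, map_inv] at h1
      have h2 : c * of (φ h : B) * c⁻¹ = of y * of (φ h : B) * (of y)⁻¹ := by
        simpa [hc, equiv_eq_conj, mul_assoc] using h1
      rw [mul_inv_eq_iff_eq_mul] at h2
      change _ * _ = _ * _
      rw [mul_assoc, h2]
      group
    have hyc' : of y * c = c * of y := by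
      have := hyc.eq
      rw [mul_assoc, inv_mul_eq_iff_eq_mul] at this
      have := congrArg (fun z => z * c⁻¹ * of y) this
      simpa [mul_assoc] using this.symm
    have h1 : c ∈ startsWith φ 1 := by
      simpa using (hattr b hbH (of 1) (of_notMem_startsWith _ _)).1
    have h2 : of y * c ∈ startsWith φ 1 := by
      rw [hyc']
      exact (hattr b hbH _ (of_notMem_startsWith _ _)).1
    have hyK : y ∈ K := (eq_and_mem_of_of_mul_mem_startsWith h1 h2).2
    set k : H := φ.symm ⟨y, hyK⟩ with hk
    have hkb : (k : B)⁻¹ * b ∉ H := fun h => hbH ((H.mul_mem_cancel_left (H.inv_mem k.2)).1 h)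
    have hkb' : of ((k : B)⁻¹ * b) ∈ residualClosure C (H.map (of (φ := φ))) := by
      rw [map_mul]
      exact mul_mem (le_residualClosure _ ⟨_, H.inv_mem k.2, rfl⟩) hb
    have hcent : ∀ s ∈ H.map (of (φ := φ)), Commute (of ((k : B)⁻¹ * b)) s := by
      rintro _ ⟨h, hh, rfl⟩
      refine Commute.map ?_ of
      have h3 : φ ⟨b * h * b⁻¹, hH.conj_mem h hh b⟩ = φ (k * ⟨h, hh⟩ * k⁻¹) := by
        ext
        simpa [hk] using hy ⟨h, hh⟩
      have h4 := congrArg Subtype.val (φ.injective h3)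
      simp only [Subgroup.coe_mul, Subgroup.coe_inv] at h4
      rw [mul_inv_eq_iff_eq_mul] at h4
      change _ * _ = _ * _
      rw [mul_assoc, h4]
      group
    have hcomm := hres.commute_of_mem_residualClosure hcent
      (conj_mem_residualClosure hrS hkb')
    have hq := hattr_rar _ hkb
    have h3 := hsubset (hq (of 1) fun h => of_notMem_startsWith _ _ (hsubset h)).1
    have h4 := hsubset (hq (of ((k : B)⁻¹ * b)) fun h => of_notMem_startsWith _ _ (hsubset h)).1
    rw [map_one, mul_one] at h3
    rw [← hcomm.eq] at h4
    exact hkb (eq_and_mem_of_of_mul_mem_startsWith h3 h4).2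

theorem conj_mem_autOf (H : Subgroup B) (h : H) : MulAut.conj h ∈ autOf B H :=
  ⟨h, fun _ => by simp⟩

theorem conj_mem_frakK (φ : H ≃* K) (h : H) : MulAut.conj h ∈ frakK H K φ :=
  ⟨_, conj_mem_autOf K (φ h), by ext; simp [autConjHom]⟩

theorem exists_conj_of_frakK_le (hH : H.Normal) (hK : K.Normal) (h : frakK H K φ ≤ autOf B H)
    (x : B) : ∃ y : B, ∀ h : H,
      (φ ⟨y * h * y⁻¹, hH.conj_mem h h.2 y⟩ : B) = x * φ h * x⁻¹ := by
  obtain ⟨y, hy⟩ := h (Subgroup.mem_map_of_mem (autConjHom φ)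
    (show MulAut.conjNormal x ∈ autOf B K from ⟨x, fun _ => MulAut.conjNormal_apply _ _⟩))
  refine ⟨y, fun h => ?_⟩
  have : autConjHom φ (MulAut.conjNormal x) h = ⟨y * h * y⁻¹, hH.conj_mem h h.2 y⟩ :=
    Subtype.ext (hy h)
  rw [← this]
  simp [autConjHom]

theorem exists_conj_of_le_frakK (hH : H.Normal) (h : autOf B H ≤ frakK H K φ)
    (x : B) : ∃ y : B, ∀ h : H,
      (φ ⟨x * h * x⁻¹, hH.conj_mem h h.2 x⟩ : B) = y * φ h * y⁻¹ := by
  obtain ⟨α, ⟨y, hy⟩, hα⟩ := h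
    (show MulAut.conjNormal x ∈ autOf B H from ⟨x, fun _ => MulAut.conjNormal_apply _ _⟩)
  refine ⟨y, fun h => ?_⟩
  rw [← hy]
  have : (⟨x * h * x⁻¹, hH.conj_mem h h.2 x⟩ : H) = autConjHom φ α h := by
    rw [hα]
    exact Subtype.ext (MulAut.conjNormal_apply _ _).symm
  rw [this]
  simp [autConjHom]

end Core

theorem statement_3 (C : GroupClass.{u}) (hiso : IsoClosed C)
    (hsub : SubgroupClosed C) (hquot : QuotClosed C) (hprod : FinProdClosed C)
    {B : Type u} [Group B] (H K : Subgroup B) (φ : H ≃* K)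
    (hH : H.Normal) (hK : K.Normal)
    (hinv : PhiInvL H K φ)
    (hcase : (frakU H K φ = autOf B H ∨ frakU H K φ = frakK H K φ) ∨
      (SatisfiesNontrivialIdentity H ∧ SatisfiesNontrivialIdentity K) ∨
      SatisfiesNontrivialIdentity ↥(autOf B H) ∨
      SatisfiesNontrivialIdentity ↥(frakK H K φ))
    (hres : Residually C (HNNExtension B H K φ)) :
    Residually C (B ⧸ H) ∧ Residually C (B ⧸ K) := by
  have hinv' := mem_iff_of_phiInvL hinv
  have hcase' : HasCentralWord H ∨
      (∀ x : B, ∃ y : B, ∀ h : H, (φ ⟨y * h * y⁻¹, hH.conj_mem h h.2 y⟩ : B) = x * φ h * x⁻¹) ∨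
      (∀ x : B, ∃ y : B, ∀ h : H,
        (φ ⟨x * h * x⁻¹, hH.conj_mem h h.2 x⟩ : B) = y * φ h * y⁻¹) := by
    rcases hcase with (h | h) | ⟨h, -⟩ | h | h
    · exact .inr (.inl (exists_conj_of_frakK_le hH hK (h ▸ le_sup_right)))
    · exact .inr (.inr (exists_conj_of_le_frakK hH (h ▸ le_sup_left)))
    · exact .inl h.hasCentralWord
    · exact .inl (hasCentralWord_of_conj_mem (conj_mem_autOf H) h)
    · exact .inl (hasCentralWord_of_conj_mem (conj_mem_frakK φ) h)
  refine ⟨residually_quotient_of_residualClosure hsub hquot _ fun b =>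
      mem_of_mem_residualClosure hH hK hinv' hcase' hres,
    residually_quotient_of_residualClosure hsub hquot _ fun b =>
      mem_of_mem_residualClosure hK hH (φ := φ.symm) (fun k => ?_) ?_
        (hres.of_mulEquiv (HNNExtension.swapEquiv φ))⟩
  · simpa using (hinv' (φ.symm k)).symm
  · have key : ∀ {x y : B}, (∀ h : H, (φ ⟨x * h * x⁻¹, hH.conj_mem h h.2 x⟩ : B) =
        y * φ h * y⁻¹) → ∀ k : K, (φ.symm ⟨y * k * y⁻¹, hK.conj_mem k k.2 y⟩ : B) =
          x * φ.symm k * x⁻¹ := by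
      intro x y h k
      have h1 : φ ⟨x * φ.symm k * x⁻¹, hH.conj_mem _ (φ.symm k).2 x⟩ =
          ⟨y * k * y⁻¹, hK.conj_mem k k.2 y⟩ := Subtype.ext (by simpa using h (φ.symm k))
      rw [← h1, MulEquiv.symm_apply_apply]
    rcases hcase' with h | h | h
    · exact .inl (h.of_mulEquiv φ)
    · exact .inr (.inr fun x => (h x).imp fun y hy => key hy)
    · exact .inr (.inl fun x => (h x).imp fun y hy => key hy)
end
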